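/- Quantitative Liouville-type estimate for divergence-form equations (Proposition 4.2). Let s ∈ (1/2,1), δ > 0, α ∈ (0,1) with 1+α < 2s, q ≥ 1, ε > 0, and 0 < λ ≤ Λ. Let (K(x,·))_{x∈ℝⁿ} define a divergence-form nonlocal operator L of order 2s with ellipticity constants λ, Λ. Let u ∈ C^{1+α}(ℝⁿ) with ‖u‖_{L^∞_{2s−ε}(ℝⁿ)} < ∞ and [u]_{C^{1+α}(ℝⁿ)} ≤ 1, and let f ∈ L^q_loc(ℝⁿ) with ‖f‖_{L^q(B_{1/δ})} ≤ δ. Assume that for all x, h ∈ ℝⁿ and all ρ > 0: ‖∇u‖_{L^∞(ℝⁿ)} · |σ_{−h}K(x+h,·) − K(x,·)|(B_{2ρ}(x)∖B_ρ(x)) ≤ δ |h|^α ρ^{−2s} and ‖∇u‖_{L^∞(ℝⁿ)} · |τ⁻_x K(x,·) − τ⁺_x K(x,·)|(B_{2ρ}∖B_ρ) ≤ δ ρ^{α−2s}. Suppose u is a weak solution of L(u,x) = f in B_{1/δ}. Then for every ε₀ > 0 there exists δ₀ > 0, depending only on ε₀, n, s, α, q, ε, λ, Λ, such that if δ < δ₀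 then ‖u − ℓ‖_{C¹(B₁)} ≤ ε₀, where ℓ(x) = u(0) + ∇u(0)·x. -/

import Mathlib

open MeasureTheory Metric Set
open scoped ENNReal Topology RealInnerProductSpace

noncomputable section

abbrev Euc (n : ℕ) := EuclideanSpace ℝ (Fin n)

variable {n : ℕ}

def hDeg (σ : ℝ) : ℕ := ⌈σ⌉₊ - 1

def hSemiOn (σ : ℝ) (Ω A : Set (Euc n)) (u : Euc n → ℝ) : ℝ≥0∞ :=
  ⨆ (x : A) (y : A),
    ENNReal.ofReal
      (‖iteratedFDerivWithin ℝ (hDeg σ) u Ω ↑x - iteratedFDerivWithin ℝ (hDeg σ) u Ω ↑y‖ /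
        ‖(x : Euc n) - (y : Euc n)‖ ^ (σ - (hDeg σ : ℝ)))

def hSemi (σ : ℝ) (Ω : Set (Euc n)) (u : Euc n → ℝ) : ℝ≥0∞ := hSemiOn σ Ω Ω u

def hNormOn (σ : ℝ) (Ω A : Set (Euc n)) (u : Euc n → ℝ) : ℝ≥0∞ :=
  (∑ j ∈ Finset.range (hDeg σ + 1), ⨆ x : A, ENNReal.ofReal ‖iteratedFDerivWithin ℝ j u Ω ↑x‖) +
    hSemiOn σ Ω A u

def hNorm (σ : ℝ) (Ω : Set (Euc n)) (u : Euc n → ℝ) : ℝ≥0∞ := hNormOn σ Ω Ω u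

def HolderMem (σ : ℝ) (Ω : Set (Euc n)) (u : Euc n → ℝ) : Prop :=
  ContDiffOn ℝ (hDeg σ) u Ω ∧ hNorm σ Ω u ≠ ⊤

def HolderMemLoc (σ : ℝ) (Ω : Set (Euc n)) (u : Euc n → ℝ) : Prop :=
  ContDiffOn ℝ (hDeg σ) u Ω ∧
    ∀ A : Set (Euc n), IsCompact A → A ⊆ Ω → hNormOn σ Ω A u ≠ ⊤

def supNorm (Ω : Set (Euc n)) (u : Euc n → ℝ) : ℝ≥0∞ :=
  ⨆ x : Ω, ENNReal.ofReal |u ↑x|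

def supNormW (τ : ℝ) (u : Euc n → ℝ) : ℝ≥0∞ :=
  ⨆ x : Euc n, ENNReal.ofReal (|u x| / (1 + ‖x‖ ^ τ))

def IsLevyMeasure (K : Measure (Euc n)) : Prop :=
  K {0} = 0 ∧ (∫⁻ y, ENNReal.ofReal (min 1 (‖y‖ ^ 2)) ∂K) ≠ ⊤ ∧
    Measure.map (fun y => -y) K = K

def UnifElliptic (s lam Lam : ℝ) (K : Measure (Euc n)) : Prop :=
  (∀ r : ℝ, 0 < r →
    ENNReal.ofReal (r ^ (2 * s)) * K (ball 0 (2 * r) \ ball 0 r) ≤ ENNReal.ofReal Lam) ∧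
  (∀ r : ℝ, 0 < r → ∀ e : Euc n, ‖e‖ = 1 →
    ENNReal.ofReal lam ≤
      ENNReal.ofReal (r ^ (2 * s - 2)) * ∫⁻ y in ball 0 r, ENNReal.ofReal (⟪e, y⟫ ^ 2) ∂K)

def Lop (K : Euc n → Measure (Euc n)) (u : Euc n → ℝ) (x : Euc n) : ℝ :=
  (1 / 2) * ∫ y, (2 * u x - u (x + y) - u (x - y)) ∂(K x)

def LopTI (K : Measure (Euc n)) (u : Euc n → ℝ) (x : Euc n) : ℝ :=
  (1 / 2) * ∫ y, (2 * u x - u (x + y) - u (x - y)) ∂K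

def SolvesPtwise (K : Euc n → Measure (Euc n)) (u f : Euc n → ℝ) (Ω : Set (Euc n)) : Prop :=
  ∀ x ∈ Ω, Integrable (fun y => 2 * u x - u (x + y) - u (x - y)) (K x) ∧ Lop K u x = f x

def tvDiff (μ ν : Measure (Euc n)) (A : Set (Euc n)) : ℝ≥0∞ :=
  (μ.restrict A - ν.restrict A) Set.univ + (ν.restrict A - μ.restrict A) Set.univ

def kernelHolder (s θ : ℝ) (K : Measure (Euc n)) : ℝ≥0∞ :=
  ⨆ (ρ : ℝ) (_ : 0 < ρ) (x : Euc n) (x' : Euc n)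
      (_ : x ∈ ball 0 (ρ / 2)) (_ : x' ∈ ball 0 (ρ / 2)) (_ : x ≠ x'),
    ENNReal.ofReal (ρ ^ (2 * s + θ) / ‖x - x'‖ ^ θ) *
      tvDiff (Measure.map (fun y => x - y) K) (Measure.map (fun y => x' - y) K)
        (ball 0 (2 * ρ) \ ball 0 ρ)

def KantCond (s γ : ℝ) (μ ν : Measure (Euc n)) (c : ℝ) : Prop :=
  ∀ ρ : ℝ, 0 < ρ → ∀ φ : Euc n → ℝ, ContDiff ℝ (hDeg γ) φ →
    hSemi γ Set.univ φ ≤ 1 → φ 0 = 0 →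
    |(∫ y in ball 0 (2 * ρ) \ ball 0 ρ, φ y ∂μ) -
        ∫ y in ball 0 (2 * ρ) \ ball 0 ρ, φ y ∂ν| ≤ c * ρ ^ (γ - 2 * s)

def MeasKernel (K : Euc n → Measure (Euc n)) : Prop :=
  ∀ B : Set (Euc n), MeasurableSet B → Measurable fun x => K x B

/-- Symmetry of a divergence-form kernel: `∫_A K(x,B) dx = ∫_B K(x,A) dx`
for all disjoint Borel sets. -/
def DivSymmetric (K : Euc n → Measure (Euc n)) : Prop :=
  ∀ A B : Set (Euc n), MeasurableSet A → MeasurableSet B → Disjoint A B →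
    ∫⁻ x in A, K x B = ∫⁻ x in B, K x A

/-- Uniform ellipticity of a divergence-form kernel. -/
def DivElliptic (s lam Lam : ℝ) (K : Euc n → Measure (Euc n)) : Prop :=
  (∀ x : Euc n, ∀ r : ℝ, 0 < r →
    ENNReal.ofReal (r ^ (2 * s)) * K x (ball x (2 * r) \ ball x r) ≤ ENNReal.ofReal Lam) ∧
  (∀ x : Euc n, ∀ r : ℝ, 0 < r → ∀ e : Euc n, ‖e‖ = 1 →
    ENNReal.ofReal lam ≤
      ENNReal.ofReal (r ^ (2 * s - 2)) *
        ∫⁻ z in ball x r, ENNReal.ofReal (⟪e, x - z⟫ ^ 2) ∂(K x))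

/-- Weak solution of the divergence-form equation `L(u,x) = f` in `Ω`. -/
def WeakSol (K : Euc n → Measure (Euc n)) (u f : Euc n → ℝ) (Ω : Set (Euc n)) : Prop :=
  (∫⁻ x in Ω, ∫⁻ z, ENNReal.ofReal ((u x - u z) ^ 2) ∂(K x)) ≠ ⊤ ∧
  (∫⁻ x in Ωᶜ, ∫⁻ z in Ω, ENNReal.ofReal ((u x - u z) ^ 2) ∂(K x)) ≠ ⊤ ∧
  ∀ η : Euc n → ℝ, ContDiff ℝ (⊤ : ℕ∞) η → HasCompactSupport η → tsupport η ⊆ Ω →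
    (1 / 2) * (∫ x, ∫ z, (u x - u z) * (η x - η z) ∂(K x)) = ∫ x, f x * η x

/-- `C^α` regularity in the `x`-variable of a divergence-form kernel (total variation). -/
def XReg (s α M : ℝ) (K : Euc n → Measure (Euc n)) : Prop :=
  ∀ x h : Euc n, ∀ ρ : ℝ, 0 < ρ →
    tvDiff (Measure.map (fun z => z - h) (K (x + h))) (K x) (ball x (2 * ρ) \ ball x ρ) ≤
      ENNReal.ofReal (M * ‖h‖ ^ α * ρ ^ (-(2 * s)))

/-- Quantitative almost-evenness of a divergence-form kernel. -/
def AlmostEven (s α M : ℝ) (K : Euc n → Measure (Euc n)) : Prop :=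
  ∀ x : Euc n, ∀ ρ : ℝ, 0 < ρ →
    tvDiff (Measure.map (fun z => z - x) (K x)) (Measure.map (fun z => x - z) (K x))
        (ball 0 (2 * ρ) \ ball 0 ρ) ≤
      ENNReal.ofReal (M * ρ ^ (α - 2 * s))

/-- `C^θ` regularity in the `z`-variable of a divergence-form kernel (total variation). -/
def ZReg (s θ M : ℝ) (K : Euc n → Measure (Euc n)) : Prop :=
  ∀ x : Euc n, ∀ ρ : ℝ, 0 < ρ → ∀ h : Euc n, ‖h‖ < ρ / 2 →
    tvDiff (Measure.map (fun z => z - h) (K x)) (K x) (ball x (2 * ρ) \ ball x ρ) ≤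
      ENNReal.ofReal (M * ‖h‖ ^ θ * ρ ^ (-(2 * s) - θ))

def gradSup (u : Euc n → ℝ) : ℝ≥0∞ :=
  ⨆ x : Euc n, ENNReal.ofReal ‖fderiv ℝ u x‖

def gradSupOn (Ω : Set (Euc n)) (u : Euc n → ℝ) : ℝ≥0∞ :=
  ⨆ x : Ω, ENNReal.ofReal ‖fderiv ℝ u (x : Euc n)‖

def c1Norm (Ω : Set (Euc n)) (u : Euc n → ℝ) : ℝ≥0∞ :=
  supNorm Ω u + gradSupOn Ω u

/-- The dyadic annulus `{ρ ≤ ‖y‖ < 2ρ}` centred at the origin. -/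
def annulus (n : ℕ) (ρ : ℝ) : Set (Euc n) := ball 0 (2 * ρ) \ ball 0 ρ

lemma mem_annulus {ρ : ℝ} {y : Euc n} : y ∈ annulus n ρ ↔ ρ ≤ ‖y‖ ∧ ‖y‖ < 2 * ρ := by
  simp [annulus, and_comm]

lemma measurableSet_annulus (ρ : ℝ) : MeasurableSet (annulus n ρ) :=
  measurableSet_ball.diff measurableSet_ball

lemma zpow_dyadic_pos (k : ℤ) : (0 : ℝ) < 2 ^ k := zpow_pos two_pos k

lemma iUnion_annulus {ρ : ℝ} (hρ : 0 < ρ) : (⋃ k : ℤ, annulus n (ρ * 2 ^ k)) = {0}ᶜ := by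
  ext y
  simp only [mem_iUnion, mem_annulus, mem_compl_iff, mem_singleton_iff]
  constructor
  · rintro ⟨k, h1, -⟩ rfl
    have := mul_pos hρ (zpow_dyadic_pos k)
    simp at h1
    linarith
  · intro hy
    have hy' : 0 < ‖y‖ / ρ := div_pos (norm_pos_iff.mpr hy) hρ
    obtain ⟨k, hk1, hk2⟩ := exists_mem_Ico_zpow hy' (one_lt_two : (1 : ℝ) < 2)
    refine ⟨k, ?_, ?_⟩
    · rwa [le_div_iff₀ hρ, mul_comm] at hk1
    · rw [div_lt_iff₀ hρ, zpow_add_one₀ two_ne_zero] at hk2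
      linarith

lemma pairwise_disjoint_annulus {ρ : ℝ} (hρ : 0 < ρ) :
    Pairwise (Function.onFun Disjoint fun k : ℤ => annulus n (ρ * 2 ^ k)) := by
  have key : ∀ i j : ℤ, i < j → Disjoint (annulus n (ρ * 2 ^ i)) (annulus n (ρ * 2 ^ j)) := by
    intro i j hij
    rw [Set.disjoint_left]
    intro y hy hy'
    rw [mem_annulus] at hy hy'
    have h1 : (2 : ℝ) ^ (i + 1) ≤ 2 ^ j := zpow_le_zpow_right₀ one_le_two (by omega)
    rw [zpow_add_one₀ two_ne_zero] at h1
    have := mul_le_mul_of_nonneg_left h1 hρ.le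
    linarith [hy.2, hy'.1]
  intro i j hij
  rcases lt_or_gt_of_ne hij with h | h
  · exact key i j h
  · exact (key j i h).symm

/-- The weight `min (t², t^p)`, which measures the size of second differences. -/
def wgt (p t : ℝ) : ℝ := min (t ^ 2) (t ^ p)

lemma wgt_nonneg {p t : ℝ} (ht : 0 ≤ t) : 0 ≤ wgt p t :=
  le_min (sq_nonneg t) (Real.rpow_nonneg ht p)

lemma wgt_zero (p : ℝ) (hp : p ≠ 0) : wgt p 0 = 0 := by
  simp [wgt, Real.zero_rpow hp]

lemma wgt_of_le_one {p t : ℝ} (hp : p ≤ 2) (ht0 : 0 < t) (ht : t ≤ 1) : wgt p t = t ^ 2 := by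
  refine min_eq_left ?_
  rw [← Real.rpow_natCast]
  exact Real.rpow_le_rpow_of_exponent_ge ht0 ht (by simpa using hp)

lemma wgt_of_one_le {p t : ℝ} (hp : p ≤ 2) (ht : 1 ≤ t) : wgt p t = t ^ p := by
  refine min_eq_right ?_
  rw [← Real.rpow_natCast]
  exact Real.rpow_le_rpow_of_exponent_le ht (by simpa using hp)

lemma wgt_mono {p t t' : ℝ} (hp : 0 ≤ p) (ht : 0 ≤ t) (h : t ≤ t') : wgt p t ≤ wgt p t' :=
  min_le_min (by gcongr) (Real.rpow_le_rpow ht h hp)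

lemma wgt_two_mul {p t : ℝ} (hp : p ≤ 2) (ht : 0 ≤ t) : wgt p (2 * t) ≤ 4 * wgt p t := by
  rw [wgt, wgt, mul_min_of_nonneg _ _ (by norm_num : (0 : ℝ) ≤ 4)]
  refine min_le_min (by nlinarith) ?_
  rw [Real.mul_rpow two_pos.le ht]
  gcongr
  calc (2 : ℝ) ^ p ≤ 2 ^ (2 : ℝ) := Real.rpow_le_rpow_of_exponent_le one_le_two hp
    _ = 4 := by norm_num

lemma continuous_wgt {p : ℝ} (hp : 0 ≤ p) : Continuous (wgt p) :=
  (continuous_pow 2).min (Real.continuous_rpow_const hp)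

lemma summable_wgt {p β : ℝ} (hp : p < β) (hβ : β < 2) :
    Summable fun k : ℤ => wgt p (2 ^ k) * ((2 : ℝ) ^ k) ^ (-β) := by
  have hp2 : p ≤ 2 := by linarith
  refine Summable.of_nat_of_neg ?_ ?_
  · have : ∀ k : ℕ, wgt p (2 ^ (k : ℤ)) * ((2 : ℝ) ^ (k : ℤ)) ^ (-β) = ((2 : ℝ) ^ (p - β)) ^ k := by
      intro k
      rw [zpow_natCast, wgt_of_one_le hp2 (one_le_pow₀ one_le_two), ← Real.rpow_add (by positivity),
        ← Real.rpow_natCast, ← Real.rpow_natCast, ← Real.rpow_mul two_pos.le,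
        ← Real.rpow_mul two_pos.le, mul_comm, sub_eq_add_neg]
    simp_rw [this]
    exact summable_geometric_of_lt_one (by positivity)
      (Real.rpow_lt_one_of_one_lt_of_neg one_lt_two (by linarith))
  · have : ∀ k : ℕ, wgt p (2 ^ (-(k : ℤ))) * ((2 : ℝ) ^ (-(k : ℤ))) ^ (-β) =
        ((2 : ℝ) ^ (β - 2)) ^ k := by
      intro k
      have h1 : ((2 : ℝ) ^ (-(k : ℤ))) ≤ 1 := zpow_le_one_of_nonpos₀ one_le_two (by simp)
      rw [wgt_of_le_one hp2 (by positivity) h1, ← Real.rpow_natCast, ← Real.rpow_add (by positivity),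
        ← Real.rpow_natCast, ← Real.rpow_intCast, ← Real.rpow_mul two_pos.le,
        ← Real.rpow_mul two_pos.le]
      congr 1
      push_cast
      ring
    simp_rw [this]
    exact summable_geometric_of_lt_one (by positivity)
      (Real.rpow_lt_one_of_one_lt_of_neg one_lt_two (by linarith))

/-- The dyadic sum controlling the integral of the weight. -/
def wgtSum (p β : ℝ) : ℝ := ∑' k : ℤ, wgt p (2 ^ k) * ((2 : ℝ) ^ k) ^ (-β)

lemma wgtSum_nonneg (p β : ℝ) : 0 ≤ wgtSum p β :=
  tsum_nonneg fun k => mul_nonneg (wgt_nonneg (zpow_dyadic_pos k).le)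
    (Real.rpow_nonneg (zpow_dyadic_pos k).le _)

/-- A measure without atom at `0` whose mass on dyadic annuli is of order `-β`. -/
def UpperBd (β Lam : ℝ) (ν : Measure (Euc n)) : Prop :=
  ν {0} = 0 ∧ ∀ ρ : ℝ, 0 < ρ → ν (annulus n ρ) ≤ ENNReal.ofReal (Lam * ρ ^ (-β))

lemma restrict_compl_zero {ν : Measure (Euc n)} (h : ν {0} = 0) : ν.restrict {0}ᶜ = ν := by
  rw [Measure.restrict_eq_self_of_ae_mem]
  rw [ae_iff]
  simpa using h

lemma UpperBd.lintegral_wgt_le {p β Lam : ℝ} {ν : Measure (Euc n)} (h : UpperBd β Lam ν)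
    (hp0 : 0 ≤ p) (hp : p < β) (hβ : β < 2) (hL : 0 ≤ Lam) {ρ : ℝ} (hρ : 0 < ρ) :
    ∫⁻ y, ENNReal.ofReal (wgt p (‖y‖ / ρ)) ∂ν ≤
      ENNReal.ofReal (4 * wgtSum p β * Lam * ρ ^ (-β)) := by
  have hterm : ∀ k : ℤ, ∫⁻ y in annulus n (ρ * 2 ^ k), ENNReal.ofReal (wgt p (‖y‖ / ρ)) ∂ν ≤
      ENNReal.ofReal (4 * Lam * ρ ^ (-β) * (wgt p (2 ^ k) * ((2 : ℝ) ^ k) ^ (-β))) := by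
    intro k
    have hk := zpow_dyadic_pos k
    calc ∫⁻ y in annulus n (ρ * 2 ^ k), ENNReal.ofReal (wgt p (‖y‖ / ρ)) ∂ν
        ≤ ∫⁻ y in annulus n (ρ * 2 ^ k), ENNReal.ofReal (4 * wgt p (2 ^ k)) ∂ν := by
          refine setLIntegral_mono' (measurableSet_annulus _) fun y hy => ?_
          refine ENNReal.ofReal_le_ofReal ?_
          refine le_trans (wgt_mono hp0 (by positivity) ?_) (wgt_two_mul (by linarith) hk.le)
          rw [div_le_iff₀ hρ]
          linarith [(mem_annulus.mp hy).2]
      _ = ENNReal.ofReal (4 * wgt p (2 ^ k)) * ν (annulus n (ρ * 2 ^ k)) := by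
          rw [setLIntegral_const]
      _ ≤ ENNReal.ofReal (4 * wgt p (2 ^ k)) * ENNReal.ofReal (Lam * (ρ * 2 ^ k) ^ (-β)) := by
          gcongr
          exact h.2 _ (by positivity)
      _ = _ := by
          rw [← ENNReal.ofReal_mul (by have := wgt_nonneg (p := p) hk.le; positivity),
            Real.mul_rpow hρ.le hk.le]
          congr 1
          ring
  calc ∫⁻ y, ENNReal.ofReal (wgt p (‖y‖ / ρ)) ∂ν
      = ∫⁻ y in ⋃ k : ℤ, annulus n (ρ * 2 ^ k), ENNReal.ofReal (wgt p (‖y‖ / ρ)) ∂ν := by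
        rw [iUnion_annulus hρ, restrict_compl_zero h.1]
    _ = ∑' k : ℤ, ∫⁻ y in annulus n (ρ * 2 ^ k), ENNReal.ofReal (wgt p (‖y‖ / ρ)) ∂ν :=
        lintegral_iUnion (fun k => measurableSet_annulus _) (pairwise_disjoint_annulus hρ) _
    _ ≤ ∑' k : ℤ, ENNReal.ofReal (4 * Lam * ρ ^ (-β) * (wgt p (2 ^ k) * ((2 : ℝ) ^ k) ^ (-β))) :=
        ENNReal.tsum_le_tsum hterm
    _ = ENNReal.ofReal (4 * wgtSum p β * Lam * ρ ^ (-β)) := by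
        rw [← ENNReal.ofReal_tsum_of_nonneg _ ((summable_wgt hp hβ).mul_left _), tsum_mul_left,
          wgtSum]
        · congr 1
          ring
        · intro k
          have := wgt_nonneg (p := p) (zpow_dyadic_pos k).le
          have := zpow_dyadic_pos k
          positivity

lemma UpperBd.integrable_wgt {p β Lam : ℝ} {ν : Measure (Euc n)} (h : UpperBd β Lam ν)
    (hp0 : 0 ≤ p) (hp : p < β) (hβ : β < 2) (hL : 0 ≤ Lam) :
    Integrable (fun y => wgt p ‖y‖) ν := by
  refine ⟨((continuous_wgt hp0).comp continuous_norm).aestronglyMeasurable, ?_⟩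
  rw [hasFiniteIntegral_iff_ofReal (Filter.Eventually.of_forall fun y => wgt_nonneg (norm_nonneg y))]
  refine lt_of_le_of_lt ?_ (ENNReal.ofReal_lt_top (r := 4 * wgtSum p β * Lam * 1 ^ (-β)))
  simpa using h.lintegral_wgt_le hp0 hp hβ hL one_pos

lemma UpperBd.measure_compl_ball_le {p β Lam : ℝ} {ν : Measure (Euc n)} (h : UpperBd β Lam ν)
    (hp0 : 0 ≤ p) (hp : p < β) (hβ : β < 2) (hL : 0 ≤ Lam) {ρ : ℝ} (hρ : 0 < ρ) :
    ν (ball 0 ρ)ᶜ ≤ ENNReal.ofReal (4 * wgtSum p β * Lam * ρ ^ (-β)) := by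
  refine le_trans ?_ (h.lintegral_wgt_le hp0 hp hβ hL hρ)
  rw [← lintegral_indicator_one measurableSet_ball.compl]
  refine lintegral_mono fun y => ?_
  refine Set.indicator_le (s := (ball (0 : Euc n) ρ)ᶜ) (f := 1)
    (g := fun y => ENNReal.ofReal (wgt p (‖y‖ / ρ))) (fun y hy => ?_) y
  have hy' : 1 ≤ ‖y‖ / ρ := by
    rw [one_le_div hρ]
    simpa using hy
  rw [wgt_of_one_le (by linarith) hy']
  simpa using Real.one_le_rpow hy' hp0

lemma UpperBd.lintegral_sq_ball_le {p β Lam : ℝ} {ν : Measure (Euc n)} (h : UpperBd β Lam ν)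
    (hp0 : 0 < p) (hp : p < β) (hβ : β < 2) (hL : 0 ≤ Lam) {ρ : ℝ} (hρ : 0 < ρ) :
    ∫⁻ y in ball 0 ρ, ENNReal.ofReal (‖y‖ ^ 2) ∂ν ≤
      ENNReal.ofReal (4 * wgtSum p β * Lam * ρ ^ (2 - β)) := by
  calc ∫⁻ y in ball 0 ρ, ENNReal.ofReal (‖y‖ ^ 2) ∂ν
      ≤ ∫⁻ y in ball 0 ρ, ENNReal.ofReal (ρ ^ 2) * ENNReal.ofReal (wgt p (‖y‖ / ρ)) ∂ν := by
        refine setLIntegral_mono' measurableSet_ball fun y hy => ?_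
        rw [← ENNReal.ofReal_mul (by positivity)]
        refine ENNReal.ofReal_le_ofReal ?_
        have hy' : ‖y‖ < ρ := by simpa using hy
        rcases eq_or_ne y 0 with rfl | hy0
        · simp [wgt_zero p hp0.ne']
        · rw [wgt_of_le_one (by linarith) (by positivity) ((div_le_one hρ).mpr hy'.le)]
          refine le_of_eq ?_
          field_simp
    _ ≤ ENNReal.ofReal (ρ ^ 2) * ∫⁻ y, ENNReal.ofReal (wgt p (‖y‖ / ρ)) ∂ν := by
        rw [lintegral_const_mul' _ _ ENNReal.ofReal_ne_top]
        gcongr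
        exact Measure.restrict_le_self
    _ ≤ ENNReal.ofReal (ρ ^ 2) * ENNReal.ofReal (4 * wgtSum p β * Lam * ρ ^ (-β)) := by
        gcongr
        exact h.lintegral_wgt_le hp0.le hp hβ hL hρ
    _ = _ := by
        rw [← ENNReal.ofReal_mul (by positivity)]
        congr 1
        rw [sub_eq_add_neg, Real.rpow_add hρ]
        norm_num
        ring

/-- Nondegeneracy of order `β` of the second moments of a measure at every scale. -/
def LowerBd (β lam : ℝ) (ν : Measure (Euc n)) : Prop :=
  ∀ r : ℝ, 0 < r → ∀ e : Euc n, ‖e‖ = 1 →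
    ENNReal.ofReal (lam * r ^ (2 - β)) ≤ ∫⁻ y in ball 0 r, ENNReal.ofReal (⟪e, y⟫ ^ 2) ∂ν

lemma exists_rpow_le {a b : ℝ} (ha : 0 < a) (hb : 0 < b) :
    ∃ t : ℝ, 0 < t ∧ t ≤ 1 ∧ ∀ ρ : ℝ, 0 ≤ ρ → ρ ≤ t → ρ ^ a ≤ b := by
  refine ⟨min 1 (b ^ (1 / a)), by positivity, min_le_left _ _, fun ρ h0 h => ?_⟩
  calc ρ ^ a ≤ (b ^ (1 / a)) ^ a := Real.rpow_le_rpow h0 (h.trans (min_le_right _ _)) ha.le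
    _ = b := by rw [← Real.rpow_mul hb.le, one_div_mul_cancel ha.ne', Real.rpow_one]

lemma exists_rpow_neg_le {a b : ℝ} (ha : 0 < a) (hb : 0 < b) :
    ∃ T : ℝ, 2 ≤ T ∧ ∀ t : ℝ, T ≤ t → t ^ (-a) ≤ b := by
  obtain ⟨t, ht0, ht1, ht⟩ := exists_rpow_le ha hb
  refine ⟨max 2 t⁻¹, le_max_left _ _, fun T hT => ?_⟩
  have hT0 : 0 < T := lt_of_lt_of_le two_pos ((le_max_left _ _).trans hT)
  rw [Real.rpow_neg hT0.le, ← Real.inv_rpow hT0.le]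
  exact ht _ (by positivity) (inv_le_of_inv_le₀ ht0 ((le_max_right _ _).trans hT))

lemma exists_mass {p β lam Lam : ℝ} (hp0 : 0 < p) (hp : p < β) (hβ : β < 2) (hlam : 0 < lam)
    (hL : 0 ≤ Lam) :
    ∃ c θ : ℝ, 0 < c ∧ 0 < θ ∧ ∀ r : ℝ, 0 < r → ∀ ϑ : ℝ, 0 < ϑ → ∃ m : ℝ, 0 < m ∧
      ∀ ν : Measure (Euc n), UpperBd β Lam ν → LowerBd β lam ν → ∀ e : Euc n, ‖e‖ = 1 →
        ∃ (a : Euc n) (Z : Set (Euc n)), MeasurableSet Z ∧ ‖a‖ ≤ r ∧ c * r ≤ |⟪e, a⟫| ∧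
          (∀ y ∈ Z, ‖y - a‖ < ϑ ∧ θ * r ≤ ‖y‖ ∧ ‖y‖ ≤ r) ∧ ENNReal.ofReal m ≤ ν Z := by
  set C := 4 * wgtSum p β * Lam with hC
  have hC0 : 0 ≤ C := by have := wgtSum_nonneg p β; positivity
  obtain ⟨c, hc0, hc1, hc⟩ := exists_rpow_le (a := 2) (b := lam / (4 * (C + 1))) two_pos
    (by positivity)
  obtain ⟨θ, hθ0, hθ1, hθ⟩ := exists_rpow_le (a := 2 - β) (b := lam / (4 * (C + 1)))
    (by linarith) (by positivity)
  have hcC : c ^ 2 * C ≤ lam / 4 := by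
    have h1 : c ^ 2 ≤ lam / (4 * (C + 1)) := by simpa using hc c hc0.le le_rfl
    calc c ^ 2 * C ≤ lam / (4 * (C + 1)) * (C + 1) := by gcongr; linarith
      _ = lam / 4 := by field_simp
  have hθC : C * θ ^ (2 - β) ≤ lam / 4 := by
    have h1 := hθ θ hθ0.le le_rfl
    calc C * θ ^ (2 - β) ≤ (C + 1) * (lam / (4 * (C + 1))) := by gcongr; linarith
      _ = lam / 4 := by field_simp
  refine ⟨c * θ, θ, by positivity, hθ0, fun r hr ϑ hϑ => ?_⟩
  obtain ⟨t, -, htf, htc⟩ := (isCompact_closedBall (0 : Euc n) r).finite_cover_balls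
    (half_pos hϑ)
  set N : ℕ := htf.toFinset.card with hN
  refine ⟨lam / 2 * r ^ (-β) / (N + 1), by positivity, fun ν hU hLo e he => ?_⟩
  set Q : Set (Euc n) := {y | θ * r ≤ ‖y‖ ∧ ‖y‖ ≤ r ∧ c * ‖y‖ ≤ |⟪e, y⟫|} with hQ
  have hQm : MeasurableSet Q := by
    refine (IsClosed.measurableSet ?_)
    refine (isClosed_le continuous_const continuous_norm).inter
      ((isClosed_le continuous_norm continuous_const).inter
        (isClosed_le (continuous_const.mul continuous_norm) ?_))
    exact (continuous_const.inner continuous_id).abs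
  have hQmass : ENNReal.ofReal (lam / 2 * r ^ (-β)) ≤ ν Q := by
    have hpt : ∀ y ∈ ball (0 : Euc n) r, ENNReal.ofReal (⟪e, y⟫ ^ 2) ≤
        ENNReal.ofReal (c ^ 2) * ENNReal.ofReal (‖y‖ ^ 2) +
          (ball (0 : Euc n) (θ * r)).indicator (fun y => ENNReal.ofReal (‖y‖ ^ 2)) y +
          Q.indicator (fun _ => ENNReal.ofReal (r ^ 2)) y := by
      intro y hy
      have hyr : ‖y‖ < r := by simpa using hy
      have hin : |⟪e, y⟫| ≤ ‖y‖ := by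
        simpa [he] using abs_real_inner_le_norm e y
      by_cases h1 : y ∈ ball (0 : Euc n) (θ * r)
      · rw [Set.indicator_of_mem h1]
        refine le_trans ?_ (le_add_right (le_add_left le_rfl))
        refine ENNReal.ofReal_le_ofReal ?_
        rw [← sq_abs]
        gcongr
      by_cases h2 : c * ‖y‖ ≤ |⟪e, y⟫|
      · have hyQ : y ∈ Q := ⟨by simpa using h1, hyr.le, h2⟩
        rw [Set.indicator_of_mem hyQ]
        refine le_trans ?_ (le_add_left le_rfl)
        refine ENNReal.ofReal_le_ofReal ?_
        rw [← sq_abs]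
        gcongr
        linarith
      · refine le_trans ?_ (le_add_right (le_add_right le_rfl))
        rw [← ENNReal.ofReal_mul (by positivity)]
        refine ENNReal.ofReal_le_ofReal ?_
        rw [← sq_abs, ← mul_pow]
        gcongr
        linarith
    have hint : ∫⁻ y in ball 0 r, ENNReal.ofReal (⟪e, y⟫ ^ 2) ∂ν ≤
        ENNReal.ofReal (c ^ 2) * ENNReal.ofReal (C * r ^ (2 - β)) +
          ENNReal.ofReal (C * (θ * r) ^ (2 - β)) + ENNReal.ofReal (r ^ 2) * ν Q := by
      refine (setLIntegral_mono' measurableSet_ball hpt).trans ?_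
      rw [lintegral_add_right _ (measurable_const.indicator hQm),
        lintegral_add_left (by fun_prop), lintegral_const_mul' _ _ ENNReal.ofReal_ne_top,
        lintegral_indicator measurableSet_ball, lintegral_indicator hQm, setLIntegral_const]
      refine add_le_add (add_le_add ?_ ?_) ?_
      · gcongr
        exact hU.lintegral_sq_ball_le hp0 hp hβ hL hr
      · refine le_trans ?_ (hU.lintegral_sq_ball_le hp0 hp hβ hL (by positivity : 0 < θ * r))
        refine lintegral_mono' ?_ le_rfl
        exact Measure.restrict_mono le_rfl Measure.restrict_le_self
      · gcongr
        exact Measure.restrict_le_self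
    have h3 := (hLo r hr e he).trans hint
    have h4 : ENNReal.ofReal (c ^ 2) * ENNReal.ofReal (C * r ^ (2 - β)) +
          ENNReal.ofReal (C * (θ * r) ^ (2 - β)) ≤ ENNReal.ofReal (lam / 2 * r ^ (2 - β)) := by
      rw [← ENNReal.ofReal_mul (by positivity), ← ENNReal.ofReal_add (by positivity)
        (by positivity)]
      refine ENNReal.ofReal_le_ofReal ?_
      rw [Real.mul_rpow hθ0.le hr.le]
      have : 0 < r ^ (2 - β) := by positivity
      nlinarith
    by_contra hcon
    push Not at hcon
    have h5 : ENNReal.ofReal (r ^ 2) * ν Q < ENNReal.ofReal (lam / 2 * r ^ (2 - β)) := by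
      calc ENNReal.ofReal (r ^ 2) * ν Q < ENNReal.ofReal (r ^ 2) * ENNReal.ofReal (lam / 2 * r ^ (-β)) :=
            (ENNReal.mul_lt_mul_iff_right (by simpa using hr.ne') ENNReal.ofReal_ne_top).mpr hcon
        _ = _ := by
            rw [← ENNReal.ofReal_mul (by positivity), sub_eq_add_neg, Real.rpow_add hr]
            congr 1
            norm_num
            ring
    have h6 := ENNReal.add_lt_add_of_le_of_lt
      (ne_top_of_le_ne_top ENNReal.ofReal_ne_top h4) h4 h5
    rw [← ENNReal.ofReal_add (by positivity) (by positivity)] at h6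
    refine absurd (h3.trans_lt h6) (not_lt.mpr (le_of_eq ?_))
    congr 1
    ring
  by_contra hcon
  push Not at hcon
  have hsmall : ∀ x ∈ htf.toFinset, ν (Q ∩ ball x (ϑ / 2)) ≤
      ENNReal.ofReal (lam / 2 * r ^ (-β) / (N + 1)) := by
    intro x _
    rcases (Q ∩ ball x (ϑ / 2)).eq_empty_or_nonempty with h | ⟨a, haQ, hax⟩
    · simp [h]
    · refine (hcon a (Q ∩ ball x (ϑ / 2)) (hQm.inter measurableSet_ball) haQ.2.1 ?_ ?_).le
      · calc c * θ * r = c * (θ * r) := by ring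
          _ ≤ c * ‖a‖ := by gcongr; exact haQ.1
          _ ≤ _ := haQ.2.2
      · rintro y ⟨hyQ, hyx⟩
        refine ⟨?_, hyQ.1, hyQ.2.1⟩
        rw [← dist_eq_norm]
        calc dist y a ≤ dist y x + dist a x := dist_triangle_right y a x
          _ < ϑ / 2 + ϑ / 2 := add_lt_add hyx hax
          _ = ϑ := by ring
  have hcov : Q ⊆ ⋃ x ∈ htf.toFinset, Q ∩ ball x (ϑ / 2) := by
    intro y hy
    have : y ∈ closedBall (0 : Euc n) r := by simpa using hy.2.1
    obtain ⟨x, hx, hyx⟩ := mem_iUnion₂.mp (htc this)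
    exact mem_iUnion₂.mpr ⟨x, by simpa using hx, hy, hyx⟩
  have h7 : ν Q ≤ ENNReal.ofReal (N * (lam / 2 * r ^ (-β) / (N + 1))) := by
    calc ν Q ≤ ∑ x ∈ htf.toFinset, ν (Q ∩ ball x (ϑ / 2)) :=
          (measure_mono hcov).trans (measure_biUnion_finset_le _ _)
      _ ≤ ∑ x ∈ htf.toFinset, ENNReal.ofReal (lam / 2 * r ^ (-β) / (N + 1)) :=
          Finset.sum_le_sum hsmall
      _ = _ := by
          rw [Finset.sum_const, nsmul_eq_mul, ENNReal.ofReal_mul (by positivity), ← hN]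
          simp
  have h8 := (ENNReal.ofReal_le_ofReal_iff (by positivity)).mp (hQmass.trans h7)
  have h9 : 0 < lam / 2 * r ^ (-β) := by positivity
  have h10 : N * (lam / 2 * r ^ (-β) / (N + 1)) < lam / 2 * r ^ (-β) := by
    rw [mul_div_assoc', div_lt_iff₀ (by positivity)]
    nlinarith
  linarith

lemma UpperBd.measureReal_compl_ball_le {p β Lam : ℝ} {ν : Measure (Euc n)}
    (h : UpperBd β Lam ν) (hp0 : 0 ≤ p) (hp : p < β) (hβ : β < 2) (hL : 0 ≤ Lam) {ρ : ℝ}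
    (hρ : 0 < ρ) : ν.real (ball 0 ρ)ᶜ ≤ 4 * wgtSum p β * Lam * ρ ^ (-β) := by
  have := wgtSum_nonneg p β
  exact ENNReal.toReal_le_of_le_ofReal (by positivity) (h.measure_compl_ball_le hp0 hp hβ hL hρ)

lemma UpperBd.setIntegral_wgt_ball_le {p β Lam : ℝ} {ν : Measure (Euc n)} (h : UpperBd β Lam ν)
    (hp0 : 0 < p) (hp : p < β) (hβ : β < 2) (hL : 0 ≤ Lam) {ρ : ℝ} (hρ : 0 < ρ) :
    ∫ y in ball 0 ρ, wgt p ‖y‖ ∂ν ≤ 4 * wgtSum p β * Lam * ρ ^ (2 - β) := by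
  have := wgtSum_nonneg p β
  rw [integral_eq_lintegral_of_nonneg_ae
    (Filter.Eventually.of_forall fun y => wgt_nonneg (norm_nonneg y))
    ((continuous_wgt hp0.le).comp continuous_norm).aestronglyMeasurable]
  refine ENNReal.toReal_le_of_le_ofReal (by positivity) ?_
  refine le_trans (lintegral_mono fun y => ?_) (h.lintegral_sq_ball_le hp0 hp hβ hL hρ)
  exact ENNReal.ofReal_le_ofReal (min_le_left _ _)

/-- The second difference `2 D(x) - D(x+y) - D(x-y)`. -/
def secDiff (D : Euc n → ℝ) (x y : Euc n) : ℝ := 2 * D x - D (x + y) - D (x - y)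

lemma integrable_secDiff {p β Lam C : ℝ} {ν : Measure (Euc n)} (h : UpperBd β Lam ν)
    (hp0 : 0 ≤ p) (hp : p < β) (hβ : β < 2) (hL : 0 ≤ Lam) {D : Euc n → ℝ} (hD : Continuous D)
    (hC : ∀ x y, |secDiff D x y| ≤ C * wgt p ‖y‖) (x : Euc n) : Integrable (secDiff D x) ν := by
  refine ((h.integrable_wgt hp0 hp hβ hL).const_mul C).mono' ?_
    (Filter.Eventually.of_forall fun y => hC x y)
  unfold secDiff
  exact Continuous.aestronglyMeasurable (by fun_prop)

/-- Near-maximality of `D` at `x` propagates along the jump measure `ν`. -/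
lemma near_max_step {p β Lam C : ℝ} (hp0 : 0 < p) (hp : p < β) (hβ : β < 2) (hL : 0 ≤ Lam)
    (hC : 0 ≤ C) {m η e : ℝ} (hm : 0 < m) (hη : 0 < η) (he : 0 < e) :
    ∃ e' T δ' : ℝ, 0 < e' ∧ e' ≤ e ∧ 2 ≤ T ∧ 0 < δ' ∧
      ∀ (ν : Measure (Euc n)) (D : Euc n → ℝ) (x : Euc n) (S : ℝ) (Z : Set (Euc n)),
        UpperBd β Lam ν → Continuous D → (∀ z, |D z| ≤ 1) →
        (∀ z y, |secDiff D z y| ≤ C * wgt p ‖y‖) → |∫ y, secDiff D x y ∂ν| ≤ δ' →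
        (∀ z ∈ ball x T, D z ≤ S) → S - e' ≤ D x → MeasurableSet Z →
        (∀ y ∈ Z, η ≤ ‖y‖ ∧ ‖y‖ ≤ 1) → ENNReal.ofReal m ≤ ν Z → ∃ y ∈ Z, S - e ≤ D (x + y) := by
  set A := 4 * wgtSum p β * Lam with hA
  have hA0 : 0 ≤ A := by have := wgtSum_nonneg p β; positivity
  have hem : 0 < e * m := by positivity
  obtain ⟨t, ht0, ht1, ht⟩ := exists_rpow_le (a := 2 - β) (b := e * m / (8 * (C * A + 1)))
    (by linarith) (by positivity)
  set ρ := min t η with hρdef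
  have hρ : 0 < ρ := lt_min ht0 hη
  have hρ1 : C * (A * ρ ^ (2 - β)) ≤ e * m / 8 := by
    have h1 := ht ρ hρ.le (min_le_left _ _)
    calc C * (A * ρ ^ (2 - β)) = C * A * ρ ^ (2 - β) := by ring
      _ ≤ (C * A + 1) * (e * m / (8 * (C * A + 1))) := by gcongr; linarith
      _ = e * m / 8 := by field_simp
  obtain ⟨T, hT2, hT⟩ := exists_rpow_neg_le (a := β) (b := e * m / (32 * (A + 1)))
    (by linarith) (by positivity)
  have hT1 : 4 * (A * T ^ (-β)) ≤ e * m / 8 := by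
    have h1 := hT T le_rfl
    calc 4 * (A * T ^ (-β)) ≤ 4 * ((A + 1) * (e * m / (32 * (A + 1)))) := by gcongr; linarith
      _ = e * m / 8 := by field_simp; norm_num
  set B := A * ρ ^ (-β) with hB
  have hB0 : 0 ≤ B := by positivity
  refine ⟨min e (e * m / (16 * (B + 1))), T, e * m / 8, by positivity, min_le_left _ _, hT2,
    by positivity, ?_⟩
  intro ν D x S Z hU hD hD1 hDC hLD hS hx hZ hZn hmZ
  set e' := min e (e * m / (16 * (B + 1))) with he'
  have he'0 : 0 < e' := by positivity
  have he'B : 2 * e' * B ≤ e * m / 8 := by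
    have h1 : e' ≤ e * m / (16 * (B + 1)) := min_le_right _ _
    calc 2 * e' * B ≤ 2 * (e * m / (16 * (B + 1))) * (B + 1) := by gcongr; linarith
      _ = e * m / 8 := by field_simp; norm_num
  by_contra hcon
  push Not at hcon
  have hT0 : 0 < T := by linarith
  have hfinρ : ν (ball 0 ρ)ᶜ ≠ ⊤ :=
    ne_top_of_le_ne_top ENNReal.ofReal_ne_top (hU.measure_compl_ball_le hp0.le hp hβ hL hρ)
  have hfinT : ν (ball 0 T)ᶜ ≠ ⊤ :=
    ne_top_of_le_ne_top ENNReal.ofReal_ne_top (hU.measure_compl_ball_le hp0.le hp hβ hL hT0)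
  have hZsub : Z ⊆ (ball 0 ρ)ᶜ := by
    intro y hy
    have : ρ ≤ ‖y‖ := (min_le_right t η).trans (hZn y hy).1
    rwa [mem_compl_iff, mem_ball_zero_iff, not_lt]
  have hfinZ : ν Z ≠ ⊤ := ne_top_of_le_ne_top hfinρ (measure_mono hZsub)
  have hmZ' : m ≤ ν.real Z := (ENNReal.ofReal_le_iff_le_toReal hfinZ).mp hmZ
  have hpt : ∀ y, Z.indicator (fun _ => e) y - (ball 0 ρ).indicator (fun y => C * wgt p ‖y‖) y
      - (ball 0 ρ)ᶜ.indicator (fun _ => 2 * e') y - (ball 0 T)ᶜ.indicator (fun _ => (4 : ℝ)) y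
      ≤ secDiff D x y := by
    intro y
    have hS1 : -1 ≤ S := by
      have h1 := hS x (by simpa using hT0)
      have h2 := (abs_le.mp (hD1 x)).1
      linarith
    by_cases hyρ : y ∈ ball (0 : Euc n) ρ
    · have hyZ : y ∉ Z := fun h => hZsub h hyρ
      rw [Set.indicator_of_notMem hyZ, Set.indicator_of_mem hyρ,
        Set.indicator_of_notMem (s := (ball (0 : Euc n) ρ)ᶜ) (not_not.mpr hyρ)]
      have h1 : 0 ≤ (ball (0 : Euc n) T)ᶜ.indicator (fun _ => (4 : ℝ)) y :=
        Set.indicator_nonneg (fun _ _ => by norm_num) _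
      have h2 := (abs_le.mp (hDC x y)).1
      linarith
    · rw [Set.indicator_of_notMem hyρ, Set.indicator_of_mem (s := (ball (0 : Euc n) ρ)ᶜ) hyρ]
      unfold secDiff
      by_cases hyT : y ∈ ball (0 : Euc n) T
      · rw [Set.indicator_of_notMem (s := (ball (0 : Euc n) T)ᶜ) (not_not.mpr hyT)]
        have h1 := hS (x + y) (by simpa [mem_ball, dist_eq_norm] using hyT)
        have h2 := hS (x - y) (by simpa [mem_ball, dist_eq_norm] using hyT)
        by_cases hyZ : y ∈ Z
        · rw [Set.indicator_of_mem hyZ]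
          have h3 := hcon y hyZ
          linarith
        · rw [Set.indicator_of_notMem hyZ]
          linarith
      · have hyZ : y ∉ Z := by
          intro h
          apply hyT
          have := (hZn y h).2
          simp only [mem_ball, dist_zero_right]
          linarith
        rw [Set.indicator_of_notMem hyZ, Set.indicator_of_mem (s := (ball (0 : Euc n) T)ᶜ) hyT]
        have h1 := (abs_le.mp (hD1 (x + y))).2
        have h2 := (abs_le.mp (hD1 (x - y))).2
        linarith
  have hi1 : Integrable (Z.indicator fun _ : Euc n => e) ν :=
    (integrable_indicator_iff hZ).mpr (integrableOn_const hfinZ)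
  have hi2 : Integrable ((ball 0 ρ).indicator fun y : Euc n => C * wgt p ‖y‖) ν :=
    (((hU.integrable_wgt hp0.le hp hβ hL).const_mul C).indicator measurableSet_ball)
  have hi3 : Integrable ((ball 0 ρ)ᶜ.indicator fun _ : Euc n => 2 * e') ν :=
    (integrable_indicator_iff measurableSet_ball.compl).mpr (integrableOn_const hfinρ)
  have hi4 : Integrable ((ball 0 T)ᶜ.indicator fun _ : Euc n => (4 : ℝ)) ν :=
    (integrable_indicator_iff measurableSet_ball.compl).mpr (integrableOn_const hfinT)
  have hint := integral_mono (((hi1.sub hi2).sub hi3).sub hi4)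
    (integrable_secDiff hU hp0.le hp hβ hL hD hDC x) hpt
  rw [integral_sub' ((hi1.sub hi2).sub hi3) hi4, integral_sub' (hi1.sub hi2) hi3,
    integral_sub' hi1 hi2, integral_indicator hZ, integral_indicator measurableSet_ball,
    integral_indicator measurableSet_ball.compl, integral_indicator measurableSet_ball.compl,
    integral_const_mul, setIntegral_const, setIntegral_const, setIntegral_const, smul_eq_mul,
    smul_eq_mul, smul_eq_mul] at hint
  have hb2 := hU.setIntegral_wgt_ball_le hp0 hp hβ hL hρ
  have hb3 := hU.measureReal_compl_ball_le hp0.le hp hβ hL hρ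
  have hb4 := hU.measureReal_compl_ball_le hp0.le hp hβ hL hT0
  rw [← hA] at hb2 hb3 hb4
  have h1 := mul_le_mul_of_nonneg_left hb2 hC
  have h2 : ν.real (ball 0 ρ)ᶜ * (2 * e') ≤ e * m / 8 :=
    (mul_le_mul_of_nonneg_right hb3 (by positivity)).trans (by linarith)
  have h3 : m * e ≤ ν.real Z * e := by gcongr
  have h4 := (abs_le.mp hLD).2
  linarith

/-- Iterating `near_max_step`: a near-maximum of the increment of `F` along `a` forces linear
growth of `F` along a chain of jumps. -/
lemma near_max_iterate {p β Lam C α : ℝ} (hα : 0 < α) (hp0 : 0 < p) (hp : p < β) (hβ : β < 2)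
    (hL : 0 ≤ Lam) (hC : 0 ≤ C) {m η e ϑ : ℝ} (hm : 0 < m) (hη : 0 < η) (he : 0 < e) (J : ℕ) :
    ∃ e' T δ' : ℝ, 0 < e' ∧ e' ≤ e ∧ 2 ≤ T ∧ 0 < δ' ∧
      ∀ (ν : Measure (Euc n)) (F : Euc n → ℝ) (a x : Euc n) (S : ℝ) (Z : Set (Euc n)),
        UpperBd β Lam ν → Continuous F → (∀ z z', |F z - F z'| ≤ ‖z - z'‖ ^ α) →
        (∀ z, |F (z + a) - F z| ≤ 1) →
        (∀ z y, |secDiff (fun z => F (z + a) - F z) z y| ≤ C * wgt p ‖y‖) →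
        (∀ z ∈ ball x T, |∫ y, secDiff (fun z => F (z + a) - F z) z y ∂ν| ≤ δ') →
        (∀ z ∈ ball x T, F (z + a) - F z ≤ S) → S - e' ≤ F (x + a) - F x → MeasurableSet Z →
        (∀ y ∈ Z, ‖y - a‖ < ϑ ∧ η ≤ ‖y‖ ∧ ‖y‖ ≤ 1) → ENNReal.ofReal m ≤ ν Z →
        ∃ z, ‖z - x‖ ≤ J ∧ J * (S - e - ϑ ^ α) ≤ F z - F x := by
  induction J with
  | zero =>
    refine ⟨e, 2, 1, he, le_rfl, le_rfl, one_pos, ?_⟩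
    intro ν F a x S Z _ _ _ _ _ _ _ _ _ _ _
    exact ⟨x, by simp, by simp⟩
  | succ J ih =>
    obtain ⟨e₁, T₁, δ₁, he₁, hee₁, hT₁, hδ₁, h₁⟩ := ih
    obtain ⟨e₂, T₂, δ₂, he₂, hee₂, hT₂, hδ₂, h₂⟩ :=
      near_max_step (n := n) hp0 hp hβ hL hC hm hη he₁
    refine ⟨e₂, max T₂ (T₁ + 1), min δ₁ δ₂, he₂, hee₂.trans hee₁, hT₂.trans (le_max_left _ _),
      lt_min hδ₁ hδ₂, ?_⟩
    intro ν F a x S Z hU hF hFα hF1 hFC hδ hS hx hZ hZn hmZ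
    have hT0 : 0 < max T₂ (T₁ + 1) := lt_of_lt_of_le (by linarith) (le_max_left _ _)
    obtain ⟨y, hyZ, hy⟩ := h₂ ν (fun z => F (z + a) - F z) x S Z hU (by fun_prop) hF1 hFC
      ((hδ x (mem_ball_self hT0)).trans (min_le_right _ _))
      (fun z hz => hS z (ball_subset_ball (le_max_left _ _) hz)) hx hZ
      (fun y hy => (hZn y hy).2) hmZ
    have hsub : ball (x + y) T₁ ⊆ ball x (max T₂ (T₁ + 1)) := by
      refine (ball_subset_ball' (?_ : T₁ + dist (x + y) x ≤ T₁ + 1)).trans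
        (ball_subset_ball (le_max_right _ _))
      simpa using (hZn y hyZ).2.2
    obtain ⟨z, hz, hFz⟩ := h₁ ν F a (x + y) S Z hU hF hFα hF1 hFC
      (fun z hz => (hδ z (hsub hz)).trans (min_le_left _ _)) (fun z hz => hS z (hsub hz)) hy hZ
      hZn hmZ
    refine ⟨z, ?_, ?_⟩
    · calc ‖z - x‖ = ‖(z - (x + y)) + y‖ := by congr 1; abel
        _ ≤ J + 1 := (norm_add_le _ _).trans (add_le_add hz (hZn y hyZ).2.2)
        _ = ((J + 1 : ℕ) : ℝ) := by push_cast; ring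
    · have h3 := (abs_le.mp (hFα (x + y) (x + a))).1
      have h4 : ‖x + y - (x + a)‖ ^ α ≤ ϑ ^ α := by
        rw [add_sub_add_left_eq_sub]
        exact Real.rpow_le_rpow (norm_nonneg _) (hZn y hyZ).1.le hα.le
      push_cast
      linarith

/-- An almost `ν`-harmonic function with increments of sublinear growth cannot increase by a fixed
amount along a point `a` charged by `ν`. -/
lemma increment_le {p β Lam C α : ℝ} (hα : 0 < α) (hα1 : α < 1) (hp0 : 0 < p) (hp : p < β)
    (hβ : β < 2) (hL : 0 ≤ Lam) (hC : 0 ≤ C) {ε : ℝ} (hε : 0 < ε) :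
    ∃ ϑ : ℝ, 0 < ϑ ∧ ∀ m η : ℝ, 0 < m → 0 < η → ∃ R δ' : ℝ, 0 < R ∧ 0 < δ' ∧
      ∀ (ν : Measure (Euc n)) (F : Euc n → ℝ) (a : Euc n) (Z : Set (Euc n)),
        UpperBd β Lam ν → Continuous F → (∀ z z', |F z - F z'| ≤ ‖z - z'‖ ^ α) →
        (∀ z y, |secDiff F z y| ≤ C * wgt p ‖y‖) →
        (∀ z ∈ ball (0 : Euc n) R, |∫ y, secDiff F z y ∂ν| ≤ δ') → ‖a‖ ≤ 1 → MeasurableSet Z →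
        (∀ y ∈ Z, ‖y - a‖ < ϑ ∧ η ≤ ‖y‖ ∧ ‖y‖ ≤ 1) → ENNReal.ofReal m ≤ ν Z →
        ∀ x ∈ ball (0 : Euc n) 2, F (x + a) - F x ≤ ε := by
  obtain ⟨ϑ, hϑ0, -, hϑ⟩ := exists_rpow_le hα (b := ε / 4) (by positivity)
  refine ⟨ϑ, hϑ0, fun m η hm hη => ?_⟩
  obtain ⟨J₀, hJ₀2, hJ₀⟩ := exists_rpow_neg_le (a := 1 - α) (b := ε / 4) (by linarith)
    (by positivity)
  obtain ⟨J, hJ⟩ := exists_nat_ge J₀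
  obtain ⟨e', T, δ', he', hee', hT, hδ', hit⟩ := near_max_iterate (n := n) (ϑ := ϑ) hα hp0 hp hβ hL
    (by positivity : 0 ≤ 2 * C) hm hη (by positivity : 0 < ε / 4) J
  obtain ⟨N, hN⟩ := exists_nat_gt (4 / e')
  have hN0 : 0 < (N : ℝ) := lt_trans (by positivity) hN
  refine ⟨2 + (N + 1) * T + 1, δ' / 2, by positivity, by positivity, ?_⟩
  intro ν F a Z hU hF hFα hFC hδ ha hZ hZn hmZ
  set D : Euc n → ℝ := fun z => F (z + a) - F z with hD
  have hD1 : ∀ z, |D z| ≤ 1 := by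
    intro z
    refine (hFα (z + a) z).trans ?_
    rw [add_sub_cancel_left]
    exact Real.rpow_le_one (norm_nonneg _) ha hα.le
  have hsec : ∀ z y, secDiff D z y = secDiff F (z + a) y - secDiff F z y := by
    intro z y
    simp only [hD, secDiff, add_right_comm z y a, sub_add_eq_add_sub]
    ring
  have hDC : ∀ z y, |secDiff D z y| ≤ 2 * C * wgt p ‖y‖ := by
    intro z y
    rw [hsec]
    refine (abs_sub _ _).trans ?_
    have h1 := hFC (z + a) y
    have h2 := hFC z y
    linarith
  have hDδ : ∀ z ∈ ball (0 : Euc n) (2 + (N + 1) * T), |∫ y, secDiff D z y ∂ν| ≤ δ' := by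
    intro z hz
    simp only [hsec]
    rw [integral_sub (integrable_secDiff hU hp0.le hp hβ hL hF hFC _)
      (integrable_secDiff hU hp0.le hp hβ hL hF hFC _)]
    refine (abs_sub _ _).trans ?_
    have hz' : ‖z‖ < 2 + (N + 1) * T := by simpa using hz
    have h1 := hδ (z + a) (by
      rw [mem_ball_zero_iff]
      exact (norm_add_le _ _).trans_lt (by linarith))
    have h2 := hδ z (by rw [mem_ball_zero_iff]; linarith)
    linarith
  set Sf : ℕ → ℝ := fun i => sSup (D '' ball 0 (2 + i * T)) with hSf
  have hbdd : ∀ i : ℕ, BddAbove (D '' ball 0 (2 + i * T)) := by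
    rintro i
    refine ⟨1, ?_⟩
    rintro _ ⟨z, -, rfl⟩
    exact (abs_le.mp (hD1 z)).2
  have hne : ∀ i : ℕ, (D '' ball 0 (2 + i * T)).Nonempty := by
    intro i
    exact ⟨D 0, 0, mem_ball_self (by positivity), rfl⟩
  have hle : ∀ (i : ℕ), ∀ z ∈ ball (0 : Euc n) (2 + i * T), D z ≤ Sf i :=
    fun i z hz => le_csSup (hbdd i) ⟨z, hz, rfl⟩
  obtain ⟨i, hiN, hi⟩ : ∃ i < N, Sf (i + 1) - Sf i ≤ e' / 2 := by
    by_contra hcon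
    push Not at hcon
    have h1 : ∀ i ≤ N, Sf 0 + i * (e' / 2) ≤ Sf i := by
      intro i
      induction i with
      | zero => intro; simp
      | succ i ih =>
        intro hi
        have h2 := ih (by omega)
        have h3 := hcon i (by omega)
        push_cast
        linarith
    have h2 := h1 N le_rfl
    have h3 : Sf N ≤ 1 := csSup_le (hne N) (by
      rintro _ ⟨z, -, rfl⟩
      exact (abs_le.mp (hD1 z)).2)
    have h4 : -1 ≤ Sf 0 := (abs_le.mp (hD1 0)).1.trans (hle 0 0 (mem_ball_self (by simp)))
    rw [div_lt_iff₀ he'] at hN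
    linarith
  obtain ⟨_, ⟨x₀, hx₀, rfl⟩, hx₀S⟩ := exists_lt_of_lt_csSup (hne i)
    (show Sf i - e' / 2 < sSup (D '' ball 0 (2 + i * T)) by simp only [hSf]; linarith)
  have hx₀' : ‖x₀‖ < 2 + i * T := by simpa using hx₀
  have hball : ball x₀ T ⊆ ball 0 (2 + ((i + 1 : ℕ) : ℝ) * T) := by
    refine ball_subset_ball' ?_
    rw [dist_zero_right]
    push_cast
    linarith
  have hball' : ball (0 : Euc n) (2 + ((i + 1 : ℕ) : ℝ) * T) ⊆ ball 0 (2 + (N + 1) * T) := by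
    refine ball_subset_ball ?_
    have : ((i + 1 : ℕ) : ℝ) ≤ N + 1 := by exact_mod_cast (by omega)
    gcongr
  obtain ⟨z, hzJ, hzF⟩ := hit ν F a x₀ (Sf (i + 1)) Z hU hF hFα hD1 hDC
    (fun z hz => hDδ z (hball' (hball hz))) (fun z hz => hle (i + 1) z (hball hz))
    (by change Sf (i + 1) - e' ≤ D x₀; linarith) hZ hZn hmZ
  have hJ0 : 0 < (J : ℝ) := by linarith
  have h1 : F z - F x₀ ≤ (J : ℝ) * (ε / 4) := by
    calc F z - F x₀ ≤ ‖z - x₀‖ ^ α := (le_abs_self _).trans (hFα z x₀)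
      _ ≤ (J : ℝ) ^ α := Real.rpow_le_rpow (norm_nonneg _) hzJ hα.le
      _ = J * (J : ℝ) ^ (-(1 - α)) := by
        nth_rewrite 2 [← Real.rpow_one (J : ℝ)]
        rw [← Real.rpow_add hJ0]
        congr 1
        ring
      _ ≤ _ := by gcongr; exact hJ₀ J hJ
  have h2 := le_of_mul_le_mul_left (hzF.trans h1) hJ0
  have h3 := hϑ ϑ hϑ0.le le_rfl
  intro x hx
  have hxS : D x ≤ Sf (i + 1) := by
    refine hle (i + 1) x (ball_subset_ball ?_ hx)
    have : 0 ≤ ((i + 1 : ℕ) : ℝ) * T := by positivity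
    linarith
  change D x ≤ ε
  linarith

/-- Almost `ν`-harmonic functions with increments of sublinear growth are almost constant on the
unit ball. -/
lemma osc_le {p β lam Lam C α : ℝ} (hα : 0 < α) (hα1 : α < 1) (hp0 : 0 < p) (hp : p < β)
    (hβ : β < 2) (hlam : 0 < lam) (hL : 0 ≤ Lam) (hC : 0 ≤ C) {ε : ℝ} (hε : 0 < ε) :
    ∃ R δ' : ℝ, 0 < R ∧ 0 < δ' ∧ ∀ (ν : Measure (Euc n)) (F : Euc n → ℝ),
      UpperBd β Lam ν → LowerBd β lam ν → Continuous F →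
      (∀ z z', |F z - F z'| ≤ ‖z - z'‖ ^ α) → (∀ z y, |secDiff F z y| ≤ C * wgt p ‖y‖) →
      (∀ z ∈ ball (0 : Euc n) R, |∫ y, secDiff F z y ∂ν| ≤ δ') → ∀ x, ‖x‖ ≤ 1 →
      |F x - F 0| ≤ ε := by
  obtain ⟨c, θ, hc, hθ, hmass⟩ := exists_mass (n := n) hp0 hp hβ hlam hL
  obtain ⟨t, ht0, ht1, ht⟩ := exists_rpow_le hα (b := ε / 2) (by positivity)
  set r := min 1 (c * t) with hr
  have hr0 : 0 < r := by positivity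
  have hr1 : r ≤ 1 := min_le_left _ _
  have hrc : (r / c) ^ α ≤ ε / 2 := by
    refine ht _ (by positivity) ?_
    rw [div_le_iff₀ hc, mul_comm]
    exact min_le_right _ _
  obtain ⟨N, hN⟩ := exists_nat_gt (1 / r ^ 2)
  have hN0 : 0 < (N : ℝ) := lt_trans (by positivity) hN
  rw [div_lt_iff₀ (by positivity)] at hN
  set ε₁ := ε / (2 * N) with hε₁
  have hε₁0 : 0 < ε₁ := by positivity
  obtain ⟨ϑ, hϑ, hinc⟩ := increment_le (n := n) hα hα1 hp0 hp hβ hL hC hε₁0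
  obtain ⟨m, hm, hmass⟩ := hmass r hr0 ϑ hϑ
  obtain ⟨R, δ', hR, hδ', hinc⟩ := hinc m (θ * r) hm (by positivity)
  refine ⟨R, δ', hR, hδ', fun ν F hU hLo hF hFα hFC hδ => ?_⟩
  have hneg : ∀ z y, secDiff (fun z => -F z) z y = -secDiff F z y := by
    intro z y
    simp only [secDiff]
    ring
  have key : ∀ (a : Euc n) (Z : Set (Euc n)), ‖a‖ ≤ r → MeasurableSet Z →
      (∀ y ∈ Z, ‖y - a‖ < ϑ ∧ θ * r ≤ ‖y‖ ∧ ‖y‖ ≤ r) → ENNReal.ofReal m ≤ ν Z →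
      ∀ x ∈ ball (0 : Euc n) 2, |F (x + a) - F x| ≤ ε₁ := by
    intro a Z ha hZ hZn hmZ x hx
    have hZn' : ∀ y ∈ Z, ‖y - a‖ < ϑ ∧ θ * r ≤ ‖y‖ ∧ ‖y‖ ≤ 1 :=
      fun y hy => ⟨(hZn y hy).1, (hZn y hy).2.1, (hZn y hy).2.2.trans hr1⟩
    have h1 := hinc ν F a Z hU hF hFα hFC hδ (ha.trans hr1) hZ hZn' hmZ x hx
    have h2 := hinc ν (fun z => -F z) a Z hU hF.neg
      (fun z z' => by
        rw [neg_sub_neg, abs_sub_comm]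
        exact hFα z z')
      (fun z y => by rw [hneg, abs_neg]; exact hFC z y)
      (fun z hz => by simp only [hneg, integral_neg, abs_neg]; exact hδ z hz)
      (ha.trans hr1) hZ hZn' hmZ x hx
    exact abs_le.mpr ⟨by linarith, h1⟩
  have main : ∀ j : ℕ, ∀ x : Euc n, ‖x‖ ≤ 1 → ‖x‖ ^ 2 ≤ j * r ^ 2 →
      |F x - F 0| ≤ (r / c) ^ α + j * ε₁ := by
    intro j
    induction j with
    | zero =>
      intro x _ hx
      have : x = 0 := by
        rw [← norm_eq_zero]
        exact pow_eq_zero_iff two_ne_zero |>.mp (le_antisymm (by simpa using hx) (by positivity))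
      rw [this, sub_self, abs_zero]
      positivity
    | succ j ih =>
      intro x hx1 hx
      by_cases hxr : ‖x‖ ≤ r / c
      · calc |F x - F 0| ≤ ‖x - 0‖ ^ α := hFα x 0
          _ ≤ (r / c) ^ α := by
            rw [sub_zero]
            exact Real.rpow_le_rpow (norm_nonneg _) hxr hα.le
          _ ≤ _ := le_add_of_nonneg_right (by positivity)
      push Not at hxr
      have hx0 : 0 < ‖x‖ := lt_trans (by positivity) hxr
      rw [div_lt_iff₀ hc] at hxr
      obtain ⟨a, Z, hZ, ha, hca, hZn, hmZ⟩ := hmass ν hU hLo (‖x‖⁻¹ • x)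
        (by rw [norm_smul, norm_inv, norm_norm, inv_mul_cancel₀ hx0.ne'])
      have hca' : c * r * ‖x‖ ≤ |⟪x, a⟫| := by
        rw [real_inner_smul_left, abs_mul, abs_of_pos (inv_pos.mpr hx0), inv_mul_eq_div,
          le_div_iff₀ hx0] at hca
        exact hca
      have hkey := key a Z ha hZ hZn hmZ
      have hstep : ∀ b : Euc n, ‖b‖ ≤ r → c * r * ‖x‖ ≤ ⟪x, b⟫ →
          ‖x - b‖ ≤ 1 ∧ ‖x - b‖ ^ 2 ≤ j * r ^ 2 := by
        intro b hb hxb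
        have h1 : ‖x - b‖ ^ 2 ≤ ‖x‖ ^ 2 - r ^ 2 := by
          rw [norm_sub_sq_real]
          have h2 : ‖b‖ ^ 2 ≤ r ^ 2 := by gcongr
          have h3 : r * r ≤ r * (‖x‖ * c) := by gcongr
          nlinarith
        push_cast at hx
        refine ⟨?_, by linarith⟩
        rw [← sq_le_one_iff₀ (norm_nonneg _)]
        have : ‖x‖ ^ 2 ≤ 1 := pow_le_one₀ (norm_nonneg _) hx1
        nlinarith [sq_nonneg r]
      obtain ⟨x', hx'1, hx'j, hxx'⟩ : ∃ x', ‖x'‖ ≤ 1 ∧ ‖x'‖ ^ 2 ≤ j * r ^ 2 ∧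
          |F x - F x'| ≤ ε₁ := by
        rcases le_abs.mp hca' with h | h
        · obtain ⟨h1, h2⟩ := hstep a ha h
          refine ⟨x - a, h1, h2, ?_⟩
          have := hkey (x - a) (by rw [mem_ball_zero_iff]; linarith)
          rwa [sub_add_cancel] at this
        · obtain ⟨h1, h2⟩ := hstep (-a) (by rwa [norm_neg]) (by rwa [inner_neg_right])
          refine ⟨x - -a, h1, h2, ?_⟩
          rw [sub_neg_eq_add, abs_sub_comm]
          exact hkey x (by rw [mem_ball_zero_iff]; linarith)
      have h4 := ih x' hx'1 hx'j
      have h5 := abs_sub_le (F x) (F x') (F 0)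
      push_cast
      linarith
  intro x hx
  have h1 := main N x hx ((pow_le_one₀ (norm_nonneg _) hx).trans hN.le)
  have h2 : N * ε₁ = ε / 2 := by rw [hε₁]; field_simp
  linarith

/-- Functions with `C^α` gradient which almost solve a translation invariant equation of order
`β > 1 + α` are almost affine on the unit ball. -/
lemma almost_affine {p β lam Lam C α : ℝ} (hα : 0 < α) (hα1 : α < 1) (hp0 : 0 < p) (hp : p < β)
    (hβ : β < 2) (hlam : 0 < lam) (hL : 0 ≤ Lam) (hC : 0 ≤ C) {ε : ℝ} (hε : 0 < ε) :
    ∃ R δ' : ℝ, 0 < R ∧ 0 < δ' ∧ ∀ (ν : Measure (Euc n)) (U : Euc n → ℝ),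
      UpperBd β Lam ν → LowerBd β lam ν → Continuous U →
      (∀ x x' k, |(U (x + k) - U x) - (U (x' + k) - U x')| ≤ ‖k‖ * ‖x - x'‖ ^ α) →
      (∀ z y, |secDiff U z y| ≤ C * wgt p ‖y‖) →
      (∀ z ∈ ball (0 : Euc n) R, |∫ y, secDiff U z y ∂ν| ≤ δ') → ∀ x k, ‖x‖ ≤ 1 → ‖k‖ ≤ 1 →
      |(U (x + k) - U x) - (U k - U 0)| ≤ ε := by
  obtain ⟨R, δ', hR, hδ', h⟩ := osc_le (n := n) (C := 2 * C) hα hα1 hp0 hp hβ hlam hL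
    (by positivity) hε
  refine ⟨R + 1, δ' / 2, by positivity, by positivity, ?_⟩
  intro ν U hU hLo hUc hUα hUC hδ x k hx hk
  have hsec : ∀ z y, secDiff (fun z => U (z + k) - U z) z y =
      secDiff U (z + k) y - secDiff U z y := by
    intro z y
    simp only [secDiff, add_right_comm z y k, sub_add_eq_add_sub]
    ring
  have := h ν (fun z => U (z + k) - U z) hU hLo (by fun_prop)
    (fun z z' => (hUα z z' k).trans
      (mul_le_of_le_one_left (by positivity) hk))
    (fun z y => by
      rw [hsec]
      refine (abs_sub _ _).trans ?_
      have h1 := hUC (z + k) y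
      have h2 := hUC z y
      linarith)
    (fun z hz => by
      simp only [hsec]
      rw [integral_sub (integrable_secDiff hU hp0.le hp hβ hL hUc hUC _)
        (integrable_secDiff hU hp0.le hp hβ hL hUc hUC _)]
      refine (abs_sub _ _).trans ?_
      have hz' : ‖z‖ < R := by simpa using hz
      have h1 := hδ (z + k) (by
        rw [mem_ball_zero_iff]
        exact (norm_add_le _ _).trans_lt (by linarith))
      have h2 := hδ z (by rw [mem_ball_zero_iff]; linarith)
      linarith) x hx
  simpa using this

/-- `φ` is a smooth probability density supported in the closed ball of radius `τ`, bounded by `B`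
and `B`-Lipschitz. -/
structure IsMollifier (τ B : ℝ) (φ : Euc n → ℝ) : Prop where
  contDiff : ContDiff ℝ (⊤ : ℕ∞) φ
  eq_zero : ∀ x, τ < ‖x‖ → φ x = 0
  nonneg : ∀ x, 0 ≤ φ x
  integral_eq : ∫ x, φ x = 1
  bound : ∀ x, |φ x| ≤ B
  lip : ∀ x y, |φ x - φ y| ≤ B * ‖x - y‖

lemma exists_isMollifier {τ : ℝ} (hτ : 0 < τ) :
    ∃ (B : ℝ) (φ : Euc n → ℝ), 0 < B ∧ IsMollifier τ B φ := by
  let b : ContDiffBump (0 : Euc n) := ⟨τ / 2, τ, by positivity, by linarith⟩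
  have hsm : ContDiff ℝ (⊤ : ℕ∞) (b.normed volume) := b.contDiff_normed
  obtain ⟨B₁, hB₁⟩ := hsm.continuous.bounded_above_of_compact_support
    (b.hasCompactSupport_normed (μ := volume))
  obtain ⟨B₂, hB₂⟩ := hsm.lipschitzWith_of_hasCompactSupport
    (b.hasCompactSupport_normed (μ := volume)) (by simp)
  refine ⟨max 1 (max B₁ B₂), b.normed volume, by positivity, hsm, fun x hx => ?_,
    b.nonneg_normed, b.integral_normed, fun x => ?_, fun x y => ?_⟩
  · by_contra h
    have h1 : x ∈ Function.support (b.normed volume) := h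
    rw [b.support_normed_eq, mem_ball_zero_iff] at h1
    exact absurd h1 (not_lt.mpr hx.le)
  · exact (hB₁ x).trans ((le_max_left _ _).trans (le_max_right _ _))
  · have := hB₂.dist_le_mul x y
    rw [Real.dist_eq, dist_eq_norm] at this
    refine this.trans ?_
    gcongr
    exact (le_max_right _ _).trans (le_max_right _ _)

lemma IsMollifier.hasCompactSupport {τ B : ℝ} {φ : Euc n → ℝ} (h : IsMollifier τ B φ) :
    HasCompactSupport φ := by
  refine HasCompactSupport.intro (isCompact_closedBall (0 : Euc n) τ) fun x hx => h.eq_zero x ?_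
  simpa using hx

/-- The convolution of `u` with `φ`. -/
def moll (φ u : Euc n → ℝ) (x : Euc n) : ℝ := ∫ z, u z * φ (x - z)

lemma moll_eq (φ u : Euc n → ℝ) (x : Euc n) : moll φ u x = ∫ w, u (x - w) * φ w := by
  rw [← integral_sub_left_eq_self _ volume x]
  simp [moll]

lemma moll_add (φ u : Euc n → ℝ) (x k : Euc n) :
    moll φ u (x + k) = ∫ z, u (z + k) * φ (x - z) := by
  rw [moll, ← integral_add_right_eq_self _ k]
  simp [add_sub_add_right_eq_sub]

section Mollification

variable {τ B α : ℝ} {φ u : Euc n → ℝ}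

lemma IsMollifier.integrable_mul (h : IsMollifier τ B φ) (hu : Continuous u) (x : Euc n) :
    Integrable fun z => u z * φ (x - z) := by
  have hc := h.contDiff.continuous
  refine Continuous.integrable_of_hasCompactSupport (by fun_prop) (HasCompactSupport.mul_left ?_)
  exact h.hasCompactSupport.comp_homeomorph (Homeomorph.subLeft x)

lemma IsMollifier.integrable_mul' (h : IsMollifier τ B φ) (hu : Continuous u) (x : Euc n) :
    Integrable fun w => u (x - w) * φ w := by
  have hc := h.contDiff.continuous
  exact Continuous.integrable_of_hasCompactSupport (by fun_prop)
    h.hasCompactSupport.mul_left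

lemma IsMollifier.integrable (h : IsMollifier τ B φ) : Integrable φ :=
  h.contDiff.continuous.integrable_of_hasCompactSupport h.hasCompactSupport

lemma IsMollifier.moll_increment_le (h : IsMollifier τ B φ) (hu : Continuous u)
    (hα : ∀ x x' k, |(u (x + k) - u x) - (u (x' + k) - u x')| ≤ ‖k‖ * ‖x - x'‖ ^ α)
    (x x' k : Euc n) :
    |(moll φ u (x + k) - moll φ u x) - (moll φ u (x' + k) - moll φ u x')| ≤
      ‖k‖ * ‖x - x'‖ ^ α := by
  have hi := h.integrable_mul' hu
  have hd : ∀ x x', Integrable fun w => u (x - w) * φ w - u (x' - w) * φ w :=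
    fun x x' => (hi x).sub (hi x')
  rw [moll_eq, moll_eq, moll_eq, moll_eq, ← integral_sub (hi _) (hi _),
    ← integral_sub (hi _) (hi _),
    ← integral_sub (hd _ _) (hd _ _), ← Real.norm_eq_abs]
  refine (norm_integral_le_of_norm_le (h.integrable.const_mul (‖k‖ * ‖x - x'‖ ^ α))
    (Filter.Eventually.of_forall fun w => ?_)).trans ?_
  · have h1 := hα (x - w) (x' - w) k
    rw [sub_sub_sub_cancel_right, sub_add_eq_add_sub, sub_add_eq_add_sub] at h1
    rw [← sub_mul, ← sub_mul, ← sub_mul, Real.norm_eq_abs, abs_mul, abs_of_nonneg (h.nonneg w)]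
    exact mul_le_mul_of_nonneg_right h1 (h.nonneg w)
  · rw [integral_const_mul, h.integral_eq, mul_one]

lemma IsMollifier.moll_approx (h : IsMollifier τ B φ) (hu : Continuous u) (hα0 : 0 ≤ α)
    (hα : ∀ x x' k, |(u (x + k) - u x) - (u (x' + k) - u x')| ≤ ‖k‖ * ‖x - x'‖ ^ α)
    (x k : Euc n) :
    |(moll φ u (x + k) - moll φ u x) - (u (x + k) - u x)| ≤ ‖k‖ * τ ^ α := by
  have hi := h.integrable_mul' hu
  have hd : Integrable fun w => u (x + k - w) * φ w - u (x - w) * φ w := (hi _).sub (hi _)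
  have h0 : u (x + k) - u x = ∫ w, (u (x + k) - u x) * φ w := by
    rw [integral_const_mul, h.integral_eq, mul_one]
  rw [h0, moll_eq, moll_eq, ← integral_sub (hi _) (hi _),
    ← integral_sub hd (h.integrable.const_mul _), ← Real.norm_eq_abs]
  refine (norm_integral_le_of_norm_le (h.integrable.const_mul (‖k‖ * τ ^ α))
    (Filter.Eventually.of_forall fun w => ?_)).trans ?_
  · rw [← sub_mul, ← sub_mul, Real.norm_eq_abs, abs_mul, abs_of_nonneg (h.nonneg w)]
    by_cases hw : τ < ‖w‖
    · simp [h.eq_zero w hw]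
    refine mul_le_mul_of_nonneg_right ?_ (h.nonneg w)
    have h1 := hα (x - w) x k
    rw [sub_sub_cancel_left, norm_neg, sub_add_eq_add_sub] at h1
    refine h1.trans ?_
    gcongr
    exact not_lt.mp hw
  · rw [integral_const_mul, h.integral_eq, mul_one]

lemma IsMollifier.continuous_moll (h : IsMollifier τ B φ) (hu : Continuous u) :
    Continuous (moll φ u) := by
  have : moll φ u = MeasureTheory.convolution φ u (ContinuousLinearMap.mul ℝ ℝ) volume := by
    ext x
    rw [moll_eq, convolution_def]
    simp only [ContinuousLinearMap.mul_apply', mul_comm]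
  rw [this]
  exact h.hasCompactSupport.continuous_convolution_left _ h.contDiff.continuous
    hu.locallyIntegrable

lemma IsMollifier.abs_secDiff_moll_le (h : IsMollifier τ B φ) (hB : 0 ≤ B) (hτ : τ ≤ 1)
    (hu : Continuous u) (hα0 : 0 < α) (hα1 : α < 1)
    (hα : ∀ x x' k, |(u (x + k) - u x) - (u (x' + k) - u x')| ≤ ‖k‖ * ‖x - x'‖ ^ α)
    (x y : Euc n) :
    |secDiff (moll φ u) x y| ≤
      (1 + 2 * B * volume.real (closedBall (0 : Euc n) 2)) * wgt (1 + α) ‖y‖ := by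
  have hV : 0 ≤ 2 * B * volume.real (closedBall (0 : Euc n) 2) := by positivity
  have hw := wgt_nonneg (p := 1 + α) (norm_nonneg y)
  rcases le_total ‖y‖ 1 with hy | hy
  · have hi := h.integrable_mul hu
    have hi' : ∀ x' , Integrable fun z => u (z - y) * φ (x' - z) :=
      h.integrable_mul (u := fun z => u (z - y)) (by fun_prop)
    have hφ : ∀ x', Integrable fun z => φ (x' - z) := fun x' => by
      simpa using h.integrable_mul (u := fun _ => 1) continuous_const x'
    have hφ1 : ∀ x', ∫ z, φ (x' - z) = 1 := fun x' => by
      rw [integral_sub_left_eq_self φ volume x', h.integral_eq]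
    have h1 : ∀ x', moll φ u (x' - y) = ∫ z, u (z - y) * φ (x' - z) := fun x' => by
      rw [sub_eq_add_neg, moll_add]
      simp only [sub_eq_add_neg]
    have hx : moll φ u x = ∫ z, u (z - y) * φ (x + y - z) := by
      rw [← h1, add_sub_cancel_right]
    have heq : secDiff (moll φ u) x y =
        -∫ z, ((u z - u (z - y)) - (u x - u (x - y))) * (φ (x + y - z) - φ (x - z)) := by
      have h2 : ∫ z, ((u z - u (z - y)) - (u x - u (x - y))) * (φ (x + y - z) - φ (x - z)) =
          ∫ z, ((u z * φ (x + y - z) - u (z - y) * φ (x + y - z)) -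
            (u z * φ (x - z) - u (z - y) * φ (x - z))) -
              ((u x - u (x - y)) * φ (x + y - z) - (u x - u (x - y)) * φ (x - z)) := by
        congr 1
        ext z
        ring
      have hd : ∀ x', Integrable fun z => u z * φ (x' - z) - u (z - y) * φ (x' - z) :=
        fun x' => (hi x').sub (hi' x')
      have hdd : Integrable fun z => (u z * φ (x + y - z) - u (z - y) * φ (x + y - z)) -
          (u z * φ (x - z) - u (z - y) * φ (x - z)) := (hd _).sub (hd _)
      have hdφ : Integrable fun z => (u x - u (x - y)) * φ (x + y - z) -
          (u x - u (x - y)) * φ (x - z) := ((hφ _).const_mul _).sub ((hφ _).const_mul _)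
      rw [h2, integral_sub hdd hdφ, integral_sub (hd _) (hd _), integral_sub (hi _) (hi' _),
        integral_sub (hi _) (hi' _), integral_sub ((hφ _).const_mul _) ((hφ _).const_mul _),
        integral_const_mul, integral_const_mul, hφ1, hφ1, ← hx, ← h1]
      simp only [secDiff, moll]
      ring
    rw [heq, abs_neg, ← Real.norm_eq_abs]
    have hbd : ∀ z, ‖((u z - u (z - y)) - (u x - u (x - y))) * (φ (x + y - z) - φ (x - z))‖ ≤
        (closedBall x 2).indicator (fun _ => 2 * B * ‖y‖ ^ 2) z := by
      intro z
      by_cases hz : z ∈ closedBall x 2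
      · rw [indicator_of_mem hz, norm_mul, Real.norm_eq_abs, Real.norm_eq_abs]
        have h3 := hα (z - y) (x - y) y
        rw [sub_add_cancel, sub_add_cancel, sub_sub_sub_cancel_right] at h3
        have h4 := h.lip (x + y - z) (x - z)
        rw [show x + y - z - (x - z) = y by abel] at h4
        have h5 : ‖z - x‖ ^ α ≤ 2 := by
          rw [mem_closedBall, dist_eq_norm] at hz
          calc ‖z - x‖ ^ α ≤ (2 : ℝ) ^ α := Real.rpow_le_rpow (norm_nonneg _) hz hα0.le
            _ ≤ (2 : ℝ) ^ (1 : ℝ) := Real.rpow_le_rpow_of_exponent_le (by norm_num) hα1.le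
            _ = 2 := Real.rpow_one 2
        calc _ ≤ (‖y‖ * 2) * (B * ‖y‖) := by
              refine mul_le_mul (h3.trans ?_) h4 (abs_nonneg _) (by positivity)
              gcongr
          _ = _ := by ring
      · rw [indicator_of_notMem hz]
        rw [mem_closedBall, dist_eq_norm, not_le, norm_sub_rev] at hz
        have h3 : φ (x - z) = 0 := h.eq_zero _ (by linarith)
        have h4 : φ (x + y - z) = 0 := by
          refine h.eq_zero _ ?_
          have h5 : ‖x - z‖ ≤ ‖x + y - z‖ + ‖y‖ := by
            calc ‖x - z‖ = ‖(x + y - z) - y‖ := by congr 1; abel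
              _ ≤ _ := norm_sub_le _ _
          linarith
        simp [h3, h4]
    refine (norm_integral_le_of_norm_le ((integrable_indicator_iff measurableSet_closedBall).mpr
      (integrableOn_const measure_closedBall_lt_top.ne))
      (Filter.Eventually.of_forall hbd)).trans ?_
    rw [integral_indicator measurableSet_closedBall, setIntegral_const, smul_eq_mul]
    have h3 : volume.real (closedBall x 2) = volume.real (closedBall (0 : Euc n) 2) := by
      simp only [Measure.real, Measure.addHaar_closedBall_center]
    rcases (norm_nonneg y).eq_or_lt with hy0 | hy0
    · rw [← hy0]
      simp only [ne_eq, OfNat.ofNat_ne_zero, not_false_eq_true, zero_pow, mul_zero]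
      rw [← hy0] at hw
      positivity
    · rw [h3, wgt_of_le_one (by linarith) hy0 hy]
      nlinarith [sq_nonneg ‖y‖]
  · have h1 := h.moll_increment_le hu hα x (x - y) y
    rw [sub_sub_cancel, sub_add_cancel, ← Real.rpow_one_add' (norm_nonneg _) (by linarith)] at h1
    rw [wgt_of_one_le (by linarith) hy] at hw ⊢
    have h2 : secDiff (moll φ u) x y =
        -(moll φ u (x + y) - moll φ u x - (moll φ u x - moll φ u (x - y))) := by
      simp only [secDiff]
      ring
    rw [h2, abs_neg]
    nlinarith

end Mollification

lemma tvDiff_comm (μ ν : Measure (Euc n)) (A : Set (Euc n)) : tvDiff μ ν A = tvDiff ν μ A :=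
  add_comm _ _

lemma setLIntegral_le_add_tvDiff {μ ν : Measure (Euc n)} {A : Set (Euc n)} (hA : MeasurableSet A)
    (hμ : μ A ≠ ⊤) (hν : ν A ≠ ⊤) {h : Euc n → ℝ≥0∞} {S : ℝ≥0∞} (hS : ∀ y ∈ A, h y ≤ S) :
    ∫⁻ y in A, h y ∂μ ≤ ∫⁻ y in A, h y ∂ν + S * tvDiff μ ν A := by
  have : IsFiniteMeasure (μ.restrict A) := isFiniteMeasure_restrict.mpr hμ
  have : IsFiniteMeasure (ν.restrict A) := isFiniteMeasure_restrict.mpr hν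
  have h1 : μ.restrict A ≤ (μ.restrict A - ν.restrict A) + ν.restrict A :=
    Measure.sub_le_iff_le_add.mp le_rfl
  have h2 : ∀ᵐ y ∂(μ.restrict A - ν.restrict A), h y ≤ S :=
    (Measure.sub_le.absolutelyContinuous).ae_le (ae_restrict_of_forall_mem hA hS)
  calc ∫⁻ y in A, h y ∂μ ≤ ∫⁻ y, h y ∂((μ.restrict A - ν.restrict A) + ν.restrict A) :=
        lintegral_mono' h1 le_rfl
    _ = ∫⁻ y, h y ∂(μ.restrict A - ν.restrict A) + ∫⁻ y in A, h y ∂ν := lintegral_add_measure _ _ _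
    _ ≤ S * (μ.restrict A - ν.restrict A) univ + ∫⁻ y in A, h y ∂ν := by
        gcongr
        calc _ ≤ ∫⁻ _, S ∂(μ.restrict A - ν.restrict A) := lintegral_mono_ae h2
          _ = _ := lintegral_const _
    _ ≤ _ := by
        rw [add_comm]
        gcongr
        exact le_self_add

lemma ofReal_abs_setIntegral_sub_le {μ ν : Measure (Euc n)} {A : Set (Euc n)}
    (hA : MeasurableSet A) (hμ : μ A ≠ ⊤) (hν : ν A ≠ ⊤) {g : Euc n → ℝ} {S : ℝ≥0∞}
    (hS : ∀ y ∈ A, ENNReal.ofReal |g y| ≤ S) (hgμ : IntegrableOn g A μ) (hgν : IntegrableOn g A ν) :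
    ENNReal.ofReal |(∫ y in A, g y ∂μ) - ∫ y in A, g y ∂ν| ≤ 2 * (S * tvDiff μ ν A) := by
  rcases eq_or_ne (S * tvDiff μ ν A) ⊤ with hT | hT
  · simp [hT]
  have hp : ∀ y ∈ A, ENNReal.ofReal (g y) ≤ S := fun y hy =>
    (ENNReal.ofReal_le_ofReal (le_abs_self _)).trans (hS y hy)
  have hn : ∀ y ∈ A, ENNReal.ofReal (-g y) ≤ S := fun y hy =>
    (ENNReal.ofReal_le_ofReal (neg_le_abs _)).trans (hS y hy)
  have h1 := setLIntegral_le_add_tvDiff hA hμ hν hp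
  have h2 := setLIntegral_le_add_tvDiff hA hν hμ hp
  have h3 := setLIntegral_le_add_tvDiff hA hμ hν hn
  have h4 := setLIntegral_le_add_tvDiff hA hν hμ hn
  rw [tvDiff_comm] at h2 h4
  have f1 := hgμ.lintegral_lt_top.ne
  have f2 := hgν.lintegral_lt_top.ne
  have f3 := hgμ.neg.lintegral_lt_top.ne
  have f4 := hgν.neg.lintegral_lt_top.ne
  simp only [Pi.neg_apply] at f3 f4
  rw [integral_eq_lintegral_pos_part_sub_lintegral_neg_part hgμ,
    integral_eq_lintegral_pos_part_sub_lintegral_neg_part hgν]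
  set T := S * tvDiff μ ν A
  have key : ∀ {a b : ℝ≥0∞}, a ≠ ⊤ → b ≠ ⊤ → a ≤ b + T → a.toReal ≤ b.toReal + T.toReal := by
    intro a b ha hb hab
    rw [← ENNReal.toReal_add hb hT]
    exact ENNReal.toReal_mono (ENNReal.add_ne_top.mpr ⟨hb, hT⟩) hab
  have k1 := key f1 f2 h1
  have k2 := key f2 f1 h2
  have k3 := key f3 f4 h3
  have k4 := key f4 f3 h4
  have : 2 * T = ENNReal.ofReal (2 * T.toReal) := by
    rw [ENNReal.ofReal_mul two_pos.le, ENNReal.ofReal_toReal hT]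
    simp
  rw [this]
  refine ENNReal.ofReal_le_ofReal (abs_le.mpr ⟨?_, ?_⟩) <;> linarith

/-- Two measures of order `β` which are close in total variation on every dyadic annulus, with a
weight `M`, have close integrals against functions controlled by the same weight. -/
lemma abs_integral_sub_le {β Lam α : ℝ} (hα : 0 < α) (hp : 1 + α < β) (hβ : β < 2)
    {μ ν : Measure (Euc n)} (hμ : UpperBd β Lam μ) (hν : UpperBd β Lam ν) {M : ℝ≥0∞} {δ a c : ℝ}
    (hδ : 0 ≤ δ) (ha : 0 ≤ a) (hc : 0 ≤ c)
    (htv : ∀ ρ : ℝ, 0 < ρ → M * tvDiff μ ν (annulus n ρ) ≤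
      ENNReal.ofReal (δ * (a + ρ ^ α) * ρ ^ (-β)))
    {g : Euc n → ℝ} (hgμ : Integrable g μ) (hgν : Integrable g ν)
    (hg : ∀ y, ENNReal.ofReal |g y| ≤ ENNReal.ofReal (c * (‖y‖ * min 1 ‖y‖)) * M) :
    |(∫ y, g y ∂μ) - ∫ y, g y ∂ν| ≤ 8 * c * δ * (a + 1) * wgtSum (1 + α) β := by
  have hterm : ∀ k : ℤ, ‖(∫ y in annulus n (1 * 2 ^ k), g y ∂μ) -
      ∫ y in annulus n (1 * 2 ^ k), g y ∂ν‖ ≤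
        8 * c * δ * (a + 1) * (wgt (1 + α) (2 ^ k) * ((2 : ℝ) ^ k) ^ (-β)) := by
    intro k
    rw [one_mul]
    set ρ : ℝ := 2 ^ k with hρ
    have hρ0 : 0 < ρ := by positivity
    have hw := wgt_nonneg (p := 1 + α) hρ0.le
    have hfin : ∀ {ν : Measure (Euc n)}, UpperBd β Lam ν → ν (annulus n ρ) ≠ ⊤ := fun h =>
      ne_top_of_le_ne_top ENNReal.ofReal_ne_top (h.2 ρ hρ0)
    have hS : ∀ y ∈ annulus n ρ, ENNReal.ofReal |g y| ≤
        ENNReal.ofReal (c * (4 * (ρ * min 1 ρ))) * M := by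
      intro y hy
      refine (hg y).trans ?_
      have hy2 : ‖y‖ ≤ 2 * ρ := ((mem_annulus.mp hy).2).le
      have h0 : ‖y‖ * min 1 ‖y‖ ≤ 4 * (ρ * min 1 ρ) := by
        calc ‖y‖ * min 1 ‖y‖ ≤ (2 * ρ) * (2 * min 1 ρ) := by
              refine mul_le_mul hy2 ?_ (by positivity) (by positivity)
              rw [mul_min_of_nonneg _ _ two_pos.le]
              exact min_le_min (by norm_num) hy2
          _ = _ := by ring
      exact mul_le_mul_left (ENNReal.ofReal_le_ofReal (mul_le_mul_of_nonneg_left h0 hc)) _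
    have h1 := ofReal_abs_setIntegral_sub_le (measurableSet_annulus ρ) (hfin hμ) (hfin hν) hS
      hgμ.integrableOn hgν.integrableOn
    rw [mul_assoc] at h1
    have h2 : ENNReal.ofReal |(∫ y in annulus n ρ, g y ∂μ) - ∫ y in annulus n ρ, g y ∂ν| ≤
        ENNReal.ofReal (2 * (c * (4 * (ρ * min 1 ρ)) * (δ * (a + ρ ^ α) * ρ ^ (-β)))) := by
      refine h1.trans ?_
      rw [ENNReal.ofReal_mul two_pos.le, ENNReal.ofReal_ofNat,
        ENNReal.ofReal_mul (p := c * (4 * (ρ * min 1 ρ))) (by positivity)]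
      exact mul_le_mul_right (mul_le_mul_right (htv ρ hρ0) _) _
    rw [ENNReal.ofReal_le_ofReal_iff (by positivity)] at h2
    rw [Real.norm_eq_abs]
    refine h2.trans ?_
    have h3 : ρ * min 1 ρ * (a + ρ ^ α) ≤ (a + 1) * wgt (1 + α) ρ := by
      rcases le_total ρ 1 with hρ1 | hρ1
      · rw [min_eq_right hρ1, wgt_of_le_one (by linarith) hρ0 hρ1]
        have : ρ ^ α ≤ 1 := Real.rpow_le_one hρ0.le hρ1 hα.le
        nlinarith [sq_nonneg ρ]
      · rw [min_eq_left hρ1, wgt_of_one_le (by linarith) hρ1, Real.rpow_add hρ0, Real.rpow_one]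
        have : 1 ≤ ρ ^ α := Real.one_le_rpow hρ1 hα.le
        have h4 : a ≤ a * ρ ^ α := le_mul_of_one_le_right ha this
        nlinarith
    have h5 : 0 ≤ 8 * c * δ * ρ ^ (-β) := by positivity
    calc 2 * (c * (4 * (ρ * min 1 ρ)) * (δ * (a + ρ ^ α) * ρ ^ (-β)))
        = 8 * c * δ * ρ ^ (-β) * (ρ * min 1 ρ * (a + ρ ^ α)) := by ring
      _ ≤ 8 * c * δ * ρ ^ (-β) * ((a + 1) * wgt (1 + α) ρ) := by gcongr
      _ = _ := by ring
  have hsum : ∀ {ν : Measure (Euc n)}, UpperBd β Lam ν → Integrable g ν →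
      HasSum (fun k : ℤ => ∫ y in annulus n (1 * 2 ^ k), g y ∂ν) (∫ y, g y ∂ν) := by
    intro ν hν hgν
    have h1 := hasSum_integral_iUnion (μ := ν) (f := g)
      (fun k : ℤ => measurableSet_annulus (1 * 2 ^ k))
      (pairwise_disjoint_annulus one_pos) hgν.integrableOn
    rwa [iUnion_annulus one_pos, restrict_compl_zero hν.1] at h1
  have hd := (hsum hμ hgμ).sub (hsum hν hgν)
  rw [← hd.tsum_eq, ← Real.norm_eq_abs]
  refine tsum_of_norm_bounded ?_ hterm
  exact (summable_wgt hp hβ).hasSum.mul_left _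

/-- The jump measure of `K` at `x`, recentred at the origin. -/
def jump (K : Euc n → Measure (Euc n)) (x : Euc n) : Measure (Euc n) :=
  (Measure.map (fun z => z - x) (K x)).restrict {0}ᶜ

lemma map_sub_apply (ν : Measure (Euc n)) (x : Euc n) (A : Set (Euc n)) :
    Measure.map (fun z => z - x) ν A = ν ((fun z => z - x) ⁻¹' A) :=
  (MeasurableEquiv.subRight x).map_apply A

lemma annulus_subset_compl_zero {ρ : ℝ} (hρ : 0 < ρ) : annulus n ρ ⊆ {0}ᶜ := by
  rintro y hy rfl
  have := (mem_annulus.mp hy).1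
  rw [norm_zero] at this
  linarith

lemma jump_restrict_annulus (K : Euc n → Measure (Euc n)) (x : Euc n) {ρ : ℝ} (hρ : 0 < ρ) :
    (jump K x).restrict (annulus n ρ) =
      (Measure.map (fun z => z - x) (K x)).restrict (annulus n ρ) :=
  Measure.restrict_restrict_of_subset (annulus_subset_compl_zero hρ)

lemma preimage_sub_annulus (x : Euc n) (ρ : ℝ) :
    (fun z => z - x) ⁻¹' annulus n ρ = ball x (2 * ρ) \ ball x ρ := by
  ext z
  simp [annulus, dist_eq_norm]

lemma UpperBd.jump {s lam Lam : ℝ} {K : Euc n → Measure (Euc n)} (h : DivElliptic s lam Lam K)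
    (x : Euc n) : UpperBd (2 * s) Lam (jump K x) := by
  refine ⟨?_, fun ρ hρ => ?_⟩
  · rw [_root_.jump, Measure.restrict_apply (measurableSet_singleton 0)]
    simp
  · rw [← Measure.restrict_apply_self, jump_restrict_annulus K x hρ, Measure.restrict_apply_self,
      map_sub_apply, preimage_sub_annulus, mul_comm Lam, Real.rpow_neg hρ.le,
      ENNReal.ofReal_mul (by positivity), ENNReal.ofReal_inv_of_pos (by positivity),
      ← ENNReal.div_eq_inv_mul, ENNReal.le_div_iff_mul_le (by left; simp; positivity)
      (by left; simp), mul_comm]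
    exact h.1 x ρ hρ

lemma LowerBd.jump {s lam Lam : ℝ} {K : Euc n → Measure (Euc n)}
    (h : DivElliptic s lam Lam K) (x : Euc n) : LowerBd (2 * s) lam (jump K x) := by
  intro r hr e he
  have h1 : ∫⁻ y in ball 0 r, ENNReal.ofReal (⟪e, y⟫ ^ 2) ∂(_root_.jump K x) =
      ∫⁻ z in ball x r, ENNReal.ofReal (⟪e, x - z⟫ ^ 2) ∂(K x) := by
    have hsupp : (Function.support fun y : Euc n => ENNReal.ofReal (⟪e, y⟫ ^ 2)) ⊆ {0}ᶜ := by
      intro y hy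
      rintro rfl
      simp at hy
    rw [_root_.jump, Measure.restrict_restrict measurableSet_ball, inter_comm,
      ← Measure.restrict_restrict (measurableSet_singleton 0).compl,
      setLIntegral_eq_of_support_subset hsupp,
      setLIntegral_map measurableSet_ball (by fun_prop) (by fun_prop)]
    have hball : (fun z => z - x) ⁻¹' ball 0 r = ball x r := by
      ext z
      simp [dist_eq_norm]
    rw [hball]
    refine lintegral_congr fun z => ?_
    rw [← neg_sub x z, inner_neg_right, neg_sq]
  rw [h1]
  have h2 := h.2 x r hr e he
  have h3 : r ^ (2 - 2 * s) * r ^ (2 * s - 2) = 1 := by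
    rw [← Real.rpow_add hr]
    simp
  calc ENNReal.ofReal (lam * r ^ (2 - 2 * s))
      = ENNReal.ofReal (r ^ (2 - 2 * s)) * ENNReal.ofReal lam := by
        rw [mul_comm, ENNReal.ofReal_mul (by positivity)]
    _ ≤ ENNReal.ofReal (r ^ (2 - 2 * s)) * (ENNReal.ofReal (r ^ (2 * s - 2)) *
          ∫⁻ z in ball x r, ENNReal.ofReal (⟪e, x - z⟫ ^ 2) ∂(K x)) := by gcongr
    _ = _ := by
        rw [← mul_assoc, ← ENNReal.ofReal_mul (by positivity), h3, ENNReal.ofReal_one, one_mul]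

/-- Kernels of order `β` are s-finite. -/
lemma isSFiniteKernel_of_upperBd {β Lam : ℝ} {κ : ProbabilityTheory.Kernel (Euc n) (Euc n)}
    (h : ∀ x, UpperBd β Lam (κ x)) : ProbabilityTheory.IsSFiniteKernel κ := by
  have hfin : ∀ k : ℤ, ProbabilityTheory.IsFiniteKernel
      (κ.restrict (measurableSet_annulus (n := n) (1 * 2 ^ k))) := by
    intro k
    refine ⟨⟨ENNReal.ofReal (Lam * (1 * 2 ^ k) ^ (-β)), ENNReal.ofReal_lt_top, fun x => ?_⟩⟩
    rw [ProbabilityTheory.Kernel.restrict_apply, Measure.restrict_apply_univ]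
    exact (h x).2 _ (by positivity)
  have heq : κ = ProbabilityTheory.Kernel.sum
      fun k : ℤ => κ.restrict (measurableSet_annulus (n := n) (1 * 2 ^ k)) := by
    ext1 x
    rw [ProbabilityTheory.Kernel.sum_apply]
    simp only [ProbabilityTheory.Kernel.restrict_apply]
    rw [← Measure.restrict_iUnion (pairwise_disjoint_annulus one_pos)
      (fun k => measurableSet_annulus _), iUnion_annulus one_pos, restrict_compl_zero (h x).1]
  rw [heq]
  exact ProbabilityTheory.Kernel.isSFiniteKernel_sum

lemma measurable_jump {s lam Lam α δ : ℝ} (hα : 0 < α) (hδ : 0 ≤ δ) {K : Euc n → Measure (Euc n)}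
    (hE : DivElliptic s lam Lam K) {M : ℝ≥0∞} (hM : M ≠ 0)
    (htv : ∀ x h : Euc n, ∀ ρ : ℝ, 0 < ρ →
      M * tvDiff (Measure.map (fun z => z - h) (K (x + h))) (K x) (ball x (2 * ρ) \ ball x ρ) ≤
        ENNReal.ofReal (δ * ‖h‖ ^ α * ρ ^ (-(2 * s)))) :
    Measurable (jump K) := by
  obtain ⟨c, hc0, hcM⟩ := ENNReal.lt_iff_exists_real_btwn.mp (pos_iff_ne_zero.mpr hM)
  have hc : 0 < c := ENNReal.ofReal_pos.mp hcM.1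
  have hcM := hcM.2.le
  have hstep : ∀ ρ : ℝ, 0 < ρ → ∀ A ⊆ annulus n ρ, MeasurableSet A →
      Measurable fun x => jump K x A := by
    intro ρ hρ A hAρ hA
    set C := c⁻¹ * δ * ρ ^ (-(2 * s)) with hC
    have hfin : ∀ x, jump K x A ≠ ⊤ := fun x =>
      ne_top_of_le_ne_top ENNReal.ofReal_ne_top ((measure_mono hAρ).trans ((UpperBd.jump hE x).2 ρ hρ))
    have hring : ∀ x, K x (ball x (2 * ρ) \ ball x ρ) ≠ ⊤ := by
      intro x
      have := (UpperBd.jump hE x).2 ρ hρ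
      rw [← Measure.restrict_apply_self, jump_restrict_annulus K x hρ, Measure.restrict_apply_self,
        map_sub_apply, preimage_sub_annulus] at this
      exact ne_top_of_le_ne_top ENNReal.ofReal_ne_top this
    have hval : ∀ x, jump K x A = K x ((fun z => z - x) ⁻¹' A) := by
      intro x
      rw [jump, Measure.restrict_eq_self _ (hAρ.trans (annulus_subset_compl_zero hρ)),
        map_sub_apply]
    have hclose : ∀ x h, |(jump K (x + h) A).toReal - (jump K x A).toReal| ≤ C * ‖h‖ ^ α := by
      intro x h
      have hT : tvDiff (Measure.map (fun z => z - h) (K (x + h))) (K x)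
          (ball x (2 * ρ) \ ball x ρ) ≤ ENNReal.ofReal (C * ‖h‖ ^ α) := by
        have h1 := (mul_le_mul_left hcM _).trans (htv x h ρ hρ)
        rw [mul_comm, ← ENNReal.le_div_iff_mul_le (by left; simpa using hc) (by left; simp),
          ← ENNReal.ofReal_div_of_pos hc] at h1
        refine h1.trans_eq ?_
        congr 1
        rw [hC]
        field_simp
      set A' := (fun z => z - x) ⁻¹' A with hA'
      have hA'm : MeasurableSet A' := hA.preimage (by fun_prop)
      have hA's : A' ⊆ ball x (2 * ρ) \ ball x ρ := by
        rw [← preimage_sub_annulus]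
        exact preimage_mono hAρ
      have hv1 : jump K (x + h) A = Measure.map (fun z => z - h) (K (x + h)) A' := by
        rw [hval, map_sub_apply, hA', ← preimage_comp]
        congr 2
        ext z
        simp [sub_sub, add_comm]
      have hr1 : Measure.map (fun z => z - h) (K (x + h)) (ball x (2 * ρ) \ ball x ρ) ≠ ⊤ := by
        have h2 := hring (x + h)
        rw [← preimage_sub_annulus] at h2 ⊢
        rw [map_sub_apply, ← preimage_comp]
        convert h2 using 3
        ext z
        simp [sub_sub, add_comm]
      have hmeas : MeasurableSet (ball x (2 * ρ) \ ball x ρ) :=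
        measurableSet_ball.diff measurableSet_ball
      have hind : ∀ y ∈ ball x (2 * ρ) \ ball x ρ, A'.indicator (1 : Euc n → ℝ≥0∞) y ≤ 1 :=
        fun y _ => indicator_le_self' (fun _ _ => zero_le_one) y
      have hi : ∀ ν : Measure (Euc n), ∫⁻ y in ball x (2 * ρ) \ ball x ρ,
          A'.indicator (1 : Euc n → ℝ≥0∞) y ∂ν = ν A' := by
        intro ν
        rw [lintegral_indicator_one hA'm, Measure.restrict_eq_self _ hA's]
      have k1 := setLIntegral_le_add_tvDiff hmeas hr1 (hring x) hind
      have k2 := setLIntegral_le_add_tvDiff hmeas (hring x) hr1 hind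
      rw [hi, hi, one_mul, ← hv1, hA', ← hval] at k1 k2
      rw [tvDiff_comm] at k2
      have hC0 : 0 ≤ C * ‖h‖ ^ α := by positivity
      have key : ∀ {a b : ℝ≥0∞}, a ≠ ⊤ → b ≠ ⊤ → a ≤ b + ENNReal.ofReal (C * ‖h‖ ^ α) →
          a.toReal ≤ b.toReal + C * ‖h‖ ^ α := by
        intro a b ha hb hab
        rw [← ENNReal.toReal_ofReal hC0, ← ENNReal.toReal_add hb ENNReal.ofReal_ne_top]
        exact ENNReal.toReal_mono (ENNReal.add_ne_top.mpr ⟨hb, ENNReal.ofReal_ne_top⟩) hab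
      have k1' := key (hfin _) (hfin _) (k1.trans (add_le_add le_rfl hT))
      have k2' := key (hfin _) (hfin _) (k2.trans (add_le_add le_rfl hT))
      exact abs_le.mpr ⟨by linarith, by linarith⟩
    have hcont : Continuous fun x => (jump K x A).toReal := by
      rw [continuous_iff_continuousAt]
      intro x
      rw [ContinuousAt, tendsto_iff_dist_tendsto_zero]
      have hlim : Filter.Tendsto (fun x' : Euc n => C * ‖x' - x‖ ^ α) (𝓝 x) (𝓝 0) := by
        have : ContinuousAt (fun x' : Euc n => C * ‖x' - x‖ ^ α) x :=
          Continuous.continuousAt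
            (continuous_const.mul ((by fun_prop : Continuous fun x' : Euc n => ‖x' - x‖).rpow_const
              fun _ => Or.inr hα.le))
        simpa [ContinuousAt, Real.zero_rpow hα.ne'] using this
      refine squeeze_zero (fun _ => dist_nonneg) (fun x' => ?_) hlim
      have := hclose x (x' - x)
      rwa [add_sub_cancel] at this
    have : (fun x => jump K x A) = fun x => ENNReal.ofReal (jump K x A).toReal := by
      ext x
      rw [ENNReal.ofReal_toReal (hfin x)]
    rw [this]
    exact ENNReal.measurable_ofReal.comp hcont.measurable
  refine Measure.measurable_of_measurable_coe _ fun A hA => ?_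
  have hsum : (fun x => jump K x A) = fun x => ∑' k : ℤ, jump K x (A ∩ annulus n (1 * 2 ^ k)) := by
    ext x
    rw [← measure_iUnion, ← inter_iUnion, iUnion_annulus one_pos, ← Measure.restrict_apply hA,
      restrict_compl_zero (UpperBd.jump hE x).1]
    · intro i j hij
      exact ((pairwise_disjoint_annulus one_pos) hij).mono inter_subset_right inter_subset_right
    · exact fun k => hA.inter (measurableSet_annulus _)
  rw [hsum]
  exact Measurable.tsum fun k => hstep _ (by positivity) _ inter_subset_right
    (hA.inter (measurableSet_annulus _))

lemma setLIntegral_jump_symm {K : Euc n → Measure (Euc n)} (h : DivSymmetric K)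
    {A B : Set (Euc n)} (hA : MeasurableSet A) (hB : MeasurableSet B) (hAB : Disjoint A B) :
    ∫⁻ x in A, jump K x ((fun y => x + y) ⁻¹' B) = ∫⁻ x in B, jump K x ((fun y => x + y) ⁻¹' A) := by
  have key : ∀ {A B : Set (Euc n)}, MeasurableSet A → MeasurableSet B → Disjoint A B →
      ∫⁻ x in A, jump K x ((fun y => x + y) ⁻¹' B) = ∫⁻ x in A, K x B := by
    intro A B hA hB hAB
    refine setLIntegral_congr_fun hA fun x hx => ?_
    change (Measure.map (fun z => z - x) (K x)).restrict {0}ᶜ _ = _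
    rw [Measure.restrict_eq_self, map_sub_apply, ← preimage_comp]
    · congr 1
      ext z
      simp
    · rintro y hy rfl
      exact disjoint_left.mp hAB hx (by simpa using hy)
  rw [key hA hB hAB, key hB hA hAB.symm, h A B hA hB hAB]

/-- The weight which turns a symmetric double integral of a function vanishing off
`(ball c 1 × univ) ∪ (univ × ball c 1)` into one over `ball c 2 × univ`. -/
def symWeight (c x z : Euc n) : ℝ :=
  (ball c 2).indicator 1 x + (ball c 1).indicator 1 x * (ball c 2)ᶜ.indicator 1 z

lemma measurable_symWeight (c : Euc n) :
    Measurable fun w : Euc n × Euc n => symWeight c w.1 w.2 := by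
  unfold symWeight
  have h : ∀ S : Set (Euc n), MeasurableSet S → Measurable (S.indicator (1 : Euc n → ℝ)) :=
    fun S hS => measurable_one.indicator hS
  exact ((h _ measurableSet_ball).comp measurable_fst).add
    (((h _ measurableSet_ball).comp measurable_fst).mul
      ((h _ measurableSet_ball.compl).comp measurable_snd))

lemma symWeight_nonneg (c x z : Euc n) : 0 ≤ symWeight c x z := by
  unfold symWeight
  exact add_nonneg (indicator_nonneg (fun _ _ => zero_le_one) _)
    (mul_nonneg (indicator_nonneg (fun _ _ => zero_le_one) _)
      (indicator_nonneg (fun _ _ => zero_le_one) _))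

lemma symWeight_le_two (c x z : Euc n) : symWeight c x z ≤ 2 := by
  have h : ∀ (S : Set (Euc n)) (y : Euc n), S.indicator (1 : Euc n → ℝ) y ≤ 1 :=
    fun S y => indicator_le_self' (fun _ _ => zero_le_one) y
  have h0 : ∀ (S : Set (Euc n)) (y : Euc n), 0 ≤ S.indicator (1 : Euc n → ℝ) y :=
    fun S y => indicator_nonneg (fun _ _ => zero_le_one) y
  have := mul_le_one₀ (h (ball c 1) x) (h0 _ _) (h (ball c 2)ᶜ z)
  have := h (ball c 2) x
  unfold symWeight
  linarith

lemma symWeight_eq_zero {c x : Euc n} (hx : x ∉ ball c 2) (z : Euc n) : symWeight c x z = 0 := by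
  have h1 : x ∉ ball c 1 := fun h => hx (ball_subset_ball one_le_two h)
  simp [symWeight, indicator_of_notMem hx, indicator_of_notMem h1]

/-- The pair measure `κ x (dy) dx` transported by `(x, y) ↦ (x, x + y)`. -/
def pairMeasure (κ : ProbabilityTheory.Kernel (Euc n) (Euc n)) : Measure (Euc n × Euc n) :=
  (volume.compProd κ).map (MeasurableEquiv.shearAddRight (Euc n))

section Pair

variable {κ : ProbabilityTheory.Kernel (Euc n) (Euc n)} [ProbabilityTheory.IsSFiniteKernel κ]

lemma lintegral_pairMeasure {g : Euc n × Euc n → ℝ≥0∞} (hg : Measurable g) :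
    ∫⁻ w, g w ∂(pairMeasure κ) = ∫⁻ x, ∫⁻ y, g (x, x + y) ∂(κ x) := by
  rw [pairMeasure, lintegral_map_equiv, Measure.lintegral_compProd]
  · rfl
  · exact hg.comp (MeasurableEquiv.shearAddRight (Euc n)).measurable

lemma integral_pairMeasure {g : Euc n × Euc n → ℝ} (hg : Integrable g (pairMeasure κ)) :
    ∫ w, g w ∂(pairMeasure κ) = ∫ x, ∫ y, g (x, x + y) ∂(κ x) := by
  rw [pairMeasure, integral_map_equiv, Measure.integral_compProd]
  · rfl
  · exact (integrable_map_equiv _ _).mp hg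

lemma pairMeasure_prod {A B : Set (Euc n)} (hA : MeasurableSet A) (hB : MeasurableSet B) :
    pairMeasure κ (A ×ˢ B) = ∫⁻ x in A, κ x ((fun y => x + y) ⁻¹' B) := by
  rw [← lintegral_indicator_one (hA.prod hB),
    lintegral_pairMeasure (measurable_one.indicator (hA.prod hB)), ← lintegral_indicator hA]
  refine lintegral_congr fun x => ?_
  by_cases hx : x ∈ A
  · rw [indicator_of_mem hx, ← lintegral_indicator_one (hB.preimage (by fun_prop))]
    refine lintegral_congr fun y => ?_
    by_cases hy : x + y ∈ B <;> simp [indicator, hx, hy]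
  · simp [indicator, hx]

variable {p β Lam C : ℝ} {c : Euc n} {F : Euc n × Euc n → ℝ}

lemma pairMeasure_restrict_swap (hp0 : 0 ≤ p) (hp : p < β) (hβ : β < 2) (hL : 0 ≤ Lam)
    (hU : ∀ x, UpperBd β Lam (κ x))
    (hsym : ∀ A B : Set (Euc n), MeasurableSet A → MeasurableSet B → Disjoint A B →
      ∫⁻ x in A, κ x ((fun y => x + y) ⁻¹' B) = ∫⁻ x in B, κ x ((fun y => x + y) ⁻¹' A)) :
    (pairMeasure κ).restrict ((ball c 2)ᶜ ×ˢ ball c 1) =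
      Measure.map Prod.swap ((pairMeasure κ).restrict (ball c 1 ×ˢ (ball c 2)ᶜ)) := by
  have hA : MeasurableSet (ball c 1) := measurableSet_ball
  have hB : MeasurableSet (ball c 2)ᶜ := measurableSet_ball.compl
  have hd : Disjoint (ball c 1) (ball c 2)ᶜ :=
    disjoint_compl_right_iff_subset.mpr (ball_subset_ball one_le_two)
  have hfin : pairMeasure κ (ball c 1 ×ˢ (ball c 2)ᶜ) < ⊤ := by
    rw [pairMeasure_prod hA hB]
    calc ∫⁻ x in ball c 1, κ x ((fun y => x + y) ⁻¹' (ball c 2)ᶜ)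
        ≤ ∫⁻ x in ball c 1, ENNReal.ofReal (4 * wgtSum p β * Lam * 1 ^ (-β)) := by
          refine setLIntegral_mono measurable_const fun x hx => ?_
          refine (measure_mono fun y hy => ?_).trans
            ((hU x).measure_compl_ball_le hp0 hp hβ hL one_pos)
          simp only [mem_preimage, mem_compl_iff, mem_ball, dist_eq_norm, sub_zero,
            not_lt] at hy hx ⊢
          have h1 : ‖x + y - c‖ ≤ ‖x - c‖ + ‖y‖ := by
            rw [add_sub_right_comm]
            exact norm_add_le _ _
          linarith
      _ < ⊤ := by
          rw [setLIntegral_const]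
          exact ENNReal.mul_lt_top ENNReal.ofReal_lt_top measure_ball_lt_top
  have hfin' : pairMeasure κ ((ball c 2)ᶜ ×ˢ ball c 1) < ⊤ := by
    rw [pairMeasure_prod hB hA, ← hsym _ _ hA hB hd, ← pairMeasure_prod hA hB]
    exact hfin
  have : IsFiniteMeasure ((pairMeasure κ).restrict ((ball c 2)ᶜ ×ˢ ball c 1)) :=
    ⟨by rwa [Measure.restrict_apply_univ]⟩
  refine Measure.ext_prod fun {S T} hS hT => ?_
  rw [Measure.map_apply measurable_swap (hS.prod hT), Measure.restrict_apply (hS.prod hT),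
    preimage_swap_prod, Measure.restrict_apply (hT.prod hS), prod_inter_prod, prod_inter_prod,
    pairMeasure_prod (hS.inter hB) (hT.inter hA), pairMeasure_prod (hT.inter hA) (hS.inter hB)]
  exact hsym _ _ (hS.inter hB) (hT.inter hA)
    (hd.symm.mono inter_subset_right inter_subset_right)

lemma integrableOn_pairMeasure (hp0 : 0 ≤ p) (hp : p < β) (hβ : β < 2) (hL : 0 ≤ Lam)
    (hC : 0 ≤ C) (hU : ∀ x, UpperBd β Lam (κ x)) (hFc : Continuous F)
    (hFb : ∀ x ∈ ball c 2, ∀ y, |F (x, x + y)| ≤ C * wgt p ‖y‖) :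
    IntegrableOn F (ball c 2 ×ˢ univ) (pairMeasure κ) := by
  have hm : MeasurableSet (ball c 2 ×ˢ (univ : Set (Euc n))) :=
    measurableSet_ball.prod MeasurableSet.univ
  refine ⟨hFc.aestronglyMeasurable, ?_⟩
  rw [HasFiniteIntegral, ← lintegral_indicator hm,
    lintegral_pairMeasure (hFc.enorm.measurable.indicator hm)]
  calc ∫⁻ x, ∫⁻ y, (ball c 2 ×ˢ univ).indicator (fun w => ‖F w‖ₑ) (x, x + y) ∂(κ x)
      ≤ ∫⁻ x, (ball c 2).indicator
          (fun _ => ENNReal.ofReal C * ENNReal.ofReal (4 * wgtSum p β * Lam * 1 ^ (-β))) x := by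
        refine lintegral_mono fun x => ?_
        by_cases hx : x ∈ ball c 2
        · rw [indicator_of_mem hx]
          refine le_trans ?_ (mul_le_mul_right ((hU x).lintegral_wgt_le hp0 hp hβ hL one_pos) _)
          rw [← lintegral_const_mul' _ _ ENNReal.ofReal_ne_top]
          refine lintegral_mono fun y => ?_
          rw [indicator_of_mem (by simpa using hx), ← ENNReal.ofReal_mul hC, div_one,
            Real.enorm_eq_ofReal_abs]
          exact ENNReal.ofReal_le_ofReal (hFb x hx y)
        · rw [indicator_of_notMem hx, lintegral_eq_zero_of_ae_eq_zero]
          refine Filter.Eventually.of_forall fun y => ?_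
          exact indicator_of_notMem (fun h => hx h.1) _
    _ < ⊤ := by
        rw [lintegral_indicator measurableSet_ball, setLIntegral_const]
        exact ENNReal.mul_lt_top (ENNReal.mul_lt_top ENNReal.ofReal_lt_top ENNReal.ofReal_lt_top)
          measure_ball_lt_top

/-- A symmetric double integral localised to one variable in a ball. -/
lemma integral_symm_eq (hp0 : 0 ≤ p) (hp : p < β) (hβ : β < 2) (hL : 0 ≤ Lam) (hC : 0 ≤ C)
    (hU : ∀ x, UpperBd β Lam (κ x))
    (hsym : ∀ A B : Set (Euc n), MeasurableSet A → MeasurableSet B → Disjoint A B →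
      ∫⁻ x in A, κ x ((fun y => x + y) ⁻¹' B) = ∫⁻ x in B, κ x ((fun y => x + y) ⁻¹' A))
    (hFc : Continuous F) (hFs : ∀ w, F w.swap = F w)
    (hF0 : ∀ x z, x ∉ ball c 1 → z ∉ ball c 1 → F (x, z) = 0)
    (hFb : ∀ x ∈ ball c 2, ∀ y, |F (x, x + y)| ≤ C * wgt p ‖y‖) :
    Integrable F (pairMeasure κ) ∧
    Integrable (fun x => ∫ y, symWeight c x (x + y) * F (x, x + y) ∂(κ x)) ∧
    ∫ x, ∫ y, F (x, x + y) ∂(κ x) =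
      ∫ x, ∫ y, symWeight c x (x + y) * F (x, x + y) ∂(κ x) := by
  have hA : MeasurableSet (ball c 1) := measurableSet_ball
  have hB : MeasurableSet (ball c 2) := measurableSet_ball
  have hAB : ball c 1 ⊆ ball c 2 := ball_subset_ball one_le_two
  have hI1 := integrableOn_pairMeasure hp0 hp hβ hL hC hU hFc hFb
  have hswap := pairMeasure_restrict_swap (c := c) hp0 hp hβ hL hU hsym
  have hI2 : IntegrableOn F (ball c 1 ×ˢ (ball c 2)ᶜ) (pairMeasure κ) :=
    hI1.mono_set (prod_mono hAB (subset_univ _))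
  have hFs' : F ∘ Prod.swap = F := funext hFs
  have hI3 : IntegrableOn F ((ball c 2)ᶜ ×ˢ ball c 1) (pairMeasure κ) := by
    rw [IntegrableOn, hswap]
    refine (MeasurableEquiv.prodComm.measurableEmbedding.integrable_map_iff (g := F)).mpr ?_
    change Integrable (F ∘ Prod.swap) _
    rw [hFs']
    exact hI2
  have hzero : ∀ w ∈ (ball c 2 ×ˢ (univ : Set (Euc n)))ᶜ, w ∉ (ball c 2)ᶜ ×ˢ ball c 1 →
      F w = 0 := by
    rintro ⟨x, z⟩ hw hw'
    have hx : x ∉ ball c 2 := fun h => hw ⟨h, mem_univ _⟩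
    exact hF0 x z (fun h => hx (hAB h)) fun h => hw' ⟨hx, h⟩
  have hI4 : IntegrableOn F (ball c 2 ×ˢ univ)ᶜ (pairMeasure κ) :=
    hI3.of_forall_sdiff_eq_zero (hB.prod MeasurableSet.univ).compl
      fun w hw => hzero w hw.1 hw.2
  have hI : Integrable F (pairMeasure κ) := by
    rw [← integrableOn_univ, ← union_compl_self (ball c 2 ×ˢ (univ : Set (Euc n)))]
    exact hI1.union hI4
  have hGeq : (fun w : Euc n × Euc n => symWeight c w.1 w.2 * F w) =
      (ball c 2 ×ˢ univ).indicator F + (ball c 1 ×ˢ (ball c 2)ᶜ).indicator F := by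
    ext ⟨x, z⟩
    by_cases h1 : x ∈ ball c 1 <;> by_cases h2 : x ∈ ball c 2 <;> by_cases h3 : z ∈ ball c 2 <;>
      simp only [symWeight, indicator, mem_prod, mem_univ, mem_compl_iff, Pi.add_apply, h1, h2, h3,
        not_true_eq_false, not_false_eq_true, and_true, and_false, if_true, if_false, Pi.one_apply] <;>
      simp
    ring
  have hG : Integrable (fun w : Euc n × Euc n => symWeight c w.1 w.2 * F w) (pairMeasure κ) := by
    rw [hGeq]
    exact (hI1.integrable_indicator (hB.prod MeasurableSet.univ)).add
      (hI2.integrable_indicator (hA.prod hB.compl))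
  refine ⟨hI, ?_, ?_⟩
  · have h := (integrable_map_equiv _ _).mp hG
    rw [Measure.compProd] at h
    have h' := h.integral_compProd
    simp only [ProbabilityTheory.Kernel.prodMkLeft_apply, ProbabilityTheory.Kernel.const_apply]
      at h'
    exact h'
  · rw [← integral_pairMeasure hI, ← integral_pairMeasure hG, hGeq]
    rw [integral_add' (hI1.integrable_indicator (hB.prod MeasurableSet.univ))
      (hI2.integrable_indicator (hA.prod hB.compl)), integral_indicator (hB.prod MeasurableSet.univ),
      integral_indicator (hA.prod hB.compl),
      ← integral_add_compl (hB.prod MeasurableSet.univ) hI]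
    congr 1
    rw [setIntegral_eq_of_subset_of_forall_sdiff_eq_zero (hB.prod MeasurableSet.univ).compl
      (s := (ball c 2)ᶜ ×ˢ ball c 1) (fun w hw h => hw.1 h.1) fun w hw => hzero w hw.1 hw.2, hswap]
    refine (MeasurableEquiv.prodComm.measurableEmbedding.integral_map (g := F)).trans ?_
    change ∫ w, (F ∘ Prod.swap) w ∂_ = _
    rw [hFs']

end Pair

lemma UpperBd.sFinite {β Lam : ℝ} {ν : Measure (Euc n)} (h : UpperBd β Lam ν) : SFinite ν := by
  have := isSFiniteKernel_of_upperBd (κ := ProbabilityTheory.Kernel.const (Euc n) ν)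
    (β := β) (Lam := Lam) fun x => by simpa using h
  have h2 : SFinite ((ProbabilityTheory.Kernel.const (Euc n) ν) 0) := inferInstance
  simpa using h2

lemma UpperBd.add {β Lam : ℝ} {μ ν : Measure (Euc n)} (hL : 0 ≤ Lam) (hμ : UpperBd β Lam μ)
    (hν : UpperBd β Lam ν) : UpperBd β (2 * Lam) (μ + ν) := by
  refine ⟨by simp [hμ.1, hν.1], fun ρ hρ => ?_⟩
  rw [Measure.add_apply, mul_assoc, two_mul, ENNReal.ofReal_add (by positivity) (by positivity)]
  exact add_le_add (hμ.2 ρ hρ) (hν.2 ρ hρ)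

lemma neg_preimage_annulus (ρ : ℝ) : (fun y : Euc n => -y) ⁻¹' annulus n ρ = annulus n ρ := by
  ext y
  simp [mem_annulus]

lemma UpperBd.map_neg {β Lam : ℝ} {ν : Measure (Euc n)} (h : UpperBd β Lam ν) :
    UpperBd β Lam (Measure.map (fun y => -y) ν) := by
  refine ⟨?_, fun ρ hρ => ?_⟩
  · rw [Measure.map_apply measurable_neg (measurableSet_singleton 0)]
    simpa using h.1
  · rw [Measure.map_apply measurable_neg (measurableSet_annulus ρ), neg_preimage_annulus]
    exact h.2 ρ hρ

lemma map_neg_add_map_neg (ν : Measure (Euc n)) :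
    Measure.map (fun y => -y) (ν + Measure.map (fun y => -y) ν) =
      ν + Measure.map (fun y => -y) ν := by
  rw [Measure.map_add _ _ measurable_neg, Measure.map_map measurable_neg measurable_neg, add_comm]
  congr 1
  convert Measure.map_id
  ext1 y
  simp

lemma setLIntegral_symm_of_even {ν : Measure (Euc n)} [SFinite ν]
    (h : Measure.map (fun y => -y) ν = ν) {A B : Set (Euc n)} (hA : MeasurableSet A)
    (hB : MeasurableSet B) :
    ∫⁻ x in A, ν ((fun y => x + y) ⁻¹' B) = ∫⁻ x in B, ν ((fun y => x + y) ⁻¹' A) := by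
  have key : ∀ {A B : Set (Euc n)}, MeasurableSet A → MeasurableSet B →
      ∫⁻ x in A, ν ((fun y => x + y) ⁻¹' B) =
        ∫⁻ y, ∫⁻ x, A.indicator 1 x * B.indicator 1 (x + y) ∂volume ∂ν := by
    intro A B hA hB
    have hm : Measurable fun w : Euc n × Euc n =>
        A.indicator (1 : Euc n → ℝ≥0∞) w.1 * B.indicator (1 : Euc n → ℝ≥0∞) (w.1 + w.2) :=
      ((measurable_one.indicator hA).comp measurable_fst).mul
        ((measurable_one.indicator hB).comp (measurable_fst.add measurable_snd))
    rw [← lintegral_lintegral_swap hm.aemeasurable, ← lintegral_indicator hA]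
    refine lintegral_congr fun x => ?_
    by_cases hx : x ∈ A
    · rw [indicator_of_mem hx, ← lintegral_indicator_one (hB.preimage (by fun_prop))]
      refine lintegral_congr fun y => ?_
      by_cases hy : x + y ∈ B <;> simp [indicator, hx, hy]
    · simp [hx]
  rw [key hA hB, key hB hA]
  conv_rhs => rw [← h]
  have hm : Measurable fun y : Euc n =>
      ∫⁻ x, B.indicator (1 : Euc n → ℝ≥0∞) x * A.indicator (1 : Euc n → ℝ≥0∞) (x + y) := by
    refine Measurable.lintegral_prod_right' (f := fun w : Euc n × Euc n =>
      B.indicator (1 : Euc n → ℝ≥0∞) w.2 * A.indicator (1 : Euc n → ℝ≥0∞) (w.2 + w.1)) ?_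
    exact ((measurable_one.indicator hB).comp measurable_snd).mul
        ((measurable_one.indicator hA).comp (measurable_snd.add measurable_fst))
  rw [lintegral_map hm measurable_neg]
  refine lintegral_congr fun y => ?_
  conv_rhs => rw [← lintegral_add_right_eq_self _ y]
  refine lintegral_congr fun x => ?_
  rw [add_neg_cancel_right, mul_comm]

/-- The integrand of the bilinear form against the test function `z ↦ φ (c - z)`. -/
def formInt (φ u : Euc n → ℝ) (c : Euc n) (w : Euc n × Euc n) : ℝ :=
  (u w.1 - u w.2) * (φ (c - w.1) - φ (c - w.2))

section Form

variable {τ B α : ℝ} {φ u : Euc n → ℝ}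

lemma formInt_swap (φ u : Euc n → ℝ) (c : Euc n) (w : Euc n × Euc n) :
    formInt φ u c w.swap = formInt φ u c w := by
  simp only [formInt, Prod.fst_swap, Prod.snd_swap]
  ring

lemma IsMollifier.continuous_formInt (h : IsMollifier τ B φ) (hu : Continuous u) (c : Euc n) :
    Continuous (formInt φ u c) := by
  have := h.contDiff.continuous
  unfold formInt
  fun_prop

lemma IsMollifier.eq_zero_of_notMem (h : IsMollifier τ B φ) (hτ : τ < 1) {c x : Euc n}
    (hx : x ∉ ball c 1) : φ (c - x) = 0 := by
  refine h.eq_zero _ (hτ.trans_le ?_)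
  simpa [dist_eq_norm, norm_sub_rev] using hx

lemma IsMollifier.formInt_eq_zero (h : IsMollifier τ B φ) (hτ : τ < 1) {c x z : Euc n}
    (hx : x ∉ ball c 1) (hz : z ∉ ball c 1) : formInt φ u c (x, z) = 0 := by
  simp [formInt, h.eq_zero_of_notMem hτ hx, h.eq_zero_of_notMem hτ hz]

lemma IsMollifier.abs_sub_le (h : IsMollifier τ B φ) (hB : 0 ≤ B) (x y : Euc n) :
    |φ x - φ y| ≤ 2 * B * min 1 ‖x - y‖ := by
  rw [mul_min_of_nonneg _ _ (by positivity : (0 : ℝ) ≤ 2 * B)]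
  refine le_min ?_ ((h.lip x y).trans ?_)
  · have := abs_sub (φ x) (φ y)
    have := h.bound x
    have := h.bound y
    linarith
  · gcongr
    linarith

lemma IsMollifier.abs_formInt_le (h : IsMollifier τ B φ) (hB : 0 ≤ B) (c x y : Euc n) :
    |formInt φ u c (x, x + y)| ≤ 2 * B * (|u (x + y) - u x| * min 1 ‖y‖) := by
  have h1 := h.abs_sub_le hB (c - x) (c - (x + y))
  have h2 : c - x - (c - (x + y)) = y := by abel
  rw [h2] at h1
  simp only [formInt, abs_mul]
  rw [abs_sub_comm (u x)]
  calc |u (x + y) - u x| * |φ (c - x) - φ (c - (x + y))|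
      ≤ |u (x + y) - u x| * (2 * B * min 1 ‖y‖) := by gcongr
    _ = _ := by ring

lemma mul_min_one_le_wgt (hα0 : 0 ≤ α) (hα1 : α ≤ 1) {L t : ℝ} (hL : 0 ≤ L) (ht : 0 ≤ t) :
    (L * t + t ^ (1 + α)) * min 1 t ≤ (L + 1) * wgt (1 + α) t := by
  rcases ht.eq_or_lt with rfl | ht0
  · simpa using mul_nonneg (by linarith) (wgt_nonneg le_rfl)
  rcases le_total t 1 with h1 | h1
  · rw [min_eq_right h1, wgt_of_le_one (by linarith) ht0 h1]
    have : t ^ (1 + α) ≤ t ^ (1 : ℝ) := Real.rpow_le_rpow_of_exponent_ge ht0 h1 (by linarith)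
    rw [Real.rpow_one] at this
    nlinarith
  · rw [min_eq_left h1, wgt_of_one_le (by linarith) h1]
    have : t ^ (1 : ℝ) ≤ t ^ (1 + α) := Real.rpow_le_rpow_of_exponent_le h1 (by linarith)
    rw [Real.rpow_one] at this
    nlinarith

lemma IsMollifier.abs_formInt_le_wgt (h : IsMollifier τ B φ) (hB : 0 ≤ B)
    (hα0 : 0 ≤ α) (hα1 : α ≤ 1)
    (hα : ∀ x x' k, |(u (x + k) - u x) - (u (x' + k) - u x')| ≤ ‖k‖ * ‖x - x'‖ ^ α)
    {c : Euc n} {L : ℝ} (hL : 0 ≤ L) (hT : ∀ y, |u (c + y) - u c| ≤ L * ‖y‖ + ‖y‖ ^ (1 + α))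
    {x : Euc n} (hx : x ∈ ball c 2) (y : Euc n) :
    |formInt φ u c (x, x + y)| ≤ 2 * B * (L + 3) * wgt (1 + α) ‖y‖ := by
  have h1 : |u (x + y) - u x| ≤ (L + 2) * ‖y‖ + ‖y‖ ^ (1 + α) := by
    have h2 := hα x c y
    have h3 : ‖x - c‖ ^ α ≤ 2 := by
      have hxc : ‖x - c‖ ≤ 2 := by
        rw [← dist_eq_norm]
        exact (mem_ball.mp hx).le
      calc ‖x - c‖ ^ α ≤ 2 ^ α := Real.rpow_le_rpow (norm_nonneg _) hxc hα0
        _ ≤ 2 ^ (1 : ℝ) := Real.rpow_le_rpow_of_exponent_le one_le_two hα1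
        _ = 2 := Real.rpow_one 2
    have h4 : ‖y‖ * ‖x - c‖ ^ α ≤ ‖y‖ * 2 := by gcongr
    have h5 := abs_sub_abs_le_abs_sub (u (x + y) - u x) (u (c + y) - u c)
    have := hT y
    linarith
  calc |formInt φ u c (x, x + y)| ≤ 2 * B * (|u (x + y) - u x| * min 1 ‖y‖) :=
        h.abs_formInt_le hB c x y
    _ ≤ 2 * B * (((L + 2) * ‖y‖ + ‖y‖ ^ (1 + α)) * min 1 ‖y‖) := by gcongr
    _ ≤ 2 * B * ((L + 2 + 1) * wgt (1 + α) ‖y‖) :=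
        mul_le_mul_of_nonneg_left
          (mul_min_one_le_wgt hα0 hα1 (by positivity) (norm_nonneg y)) (by positivity)
    _ = _ := by ring

/-- The bilinear form of a translation invariant operator tested with a mollifier. -/
lemma IsMollifier.integral_formInt_const (h : IsMollifier τ B φ) (hu : Continuous u)
    {ν : Measure (Euc n)} [SFinite ν] {c : Euc n}
    (hI : Integrable (formInt φ u c) (pairMeasure (ProbabilityTheory.Kernel.const (Euc n) ν))) :
    ∫ x, ∫ y, formInt φ u c (x, x + y) ∂ν = ∫ y, secDiff (moll φ u) c y ∂ν := by
  have hI' := (integrable_map_equiv _ _).mp hI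
  rw [Measure.compProd_const] at hI'
  have h1 := integral_prod _ hI'
  rw [integral_prod_symm _ hI'] at h1
  refine h1.symm.trans (integral_congr_ae (Filter.Eventually.of_forall fun y => ?_))
  change ∫ x, formInt φ u c (x, x + y) = _
  have i1 := h.integrable_mul hu c
  have i2 : Integrable fun x => u x * φ (c - y - x) := h.integrable_mul hu (c - y)
  have i3 : Integrable fun x => u (x + y) * φ (c - x) :=
    h.integrable_mul (hu.comp (continuous_add_const y)) c
  have i4 : Integrable fun x => u (x + y) * φ (c - (x + y)) := i1.comp_add_right y
  have e4 : ∫ x, u (x + y) * φ (c - (x + y)) = moll φ u c :=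
    integral_add_right_eq_self (fun x => u x * φ (c - x)) y
  calc ∫ x, formInt φ u c (x, x + y)
      = ∫ x, (u x * φ (c - x) - u x * φ (c - y - x) -
          (u (x + y) * φ (c - x) - u (x + y) * φ (c - (x + y)))) := by
        refine integral_congr_ae (Filter.Eventually.of_forall fun x => ?_)
        simp only [formInt]
        rw [sub_sub c y x, add_comm y x]
        ring
    _ = moll φ u c - moll φ u (c - y) - (moll φ u (c + y) - moll φ u c) := by
        have j1 : Integrable fun x => u x * φ (c - x) - u x * φ (c - y - x) := i1.sub i2
        have j2 : Integrable fun x => u (x + y) * φ (c - x) - u (x + y) * φ (c - (x + y)) :=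
          i3.sub i4
        rw [integral_sub j1 j2, integral_sub i1 i2, integral_sub i3 i4, e4, moll_add]
        rfl
    _ = _ := by
        rw [secDiff]
        ring

end Form

section Comparison

variable {κ : ProbabilityTheory.Kernel (Euc n) (Euc n)} {τ B α β Lam L δ : ℝ} {M : ℝ≥0∞}
  {φ u : Euc n → ℝ} {c : Euc n}

lemma IsMollifier.ofReal_abs_symWeight_formInt_le (h : IsMollifier τ B φ) (hB : 0 ≤ B)
    (hM : ∀ x y, ENNReal.ofReal |u (x + y) - u x| ≤ ENNReal.ofReal ‖y‖ * M) (c x y : Euc n) :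
    ENNReal.ofReal |symWeight c x (x + y) * formInt φ u c (x, x + y)| ≤
      ENNReal.ofReal (4 * B * (‖y‖ * min 1 ‖y‖)) * M := by
  have hm : 0 ≤ min 1 ‖y‖ := le_min zero_le_one (norm_nonneg y)
  have h1 : |symWeight c x (x + y) * formInt φ u c (x, x + y)| ≤
      4 * B * min 1 ‖y‖ * |u (x + y) - u x| := by
    rw [abs_mul, abs_of_nonneg (symWeight_nonneg c x _)]
    calc symWeight c x (x + y) * |formInt φ u c (x, x + y)|
        ≤ 2 * (2 * B * (|u (x + y) - u x| * min 1 ‖y‖)) :=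
          mul_le_mul (symWeight_le_two c x _) (h.abs_formInt_le hB c x y) (abs_nonneg _)
            zero_le_two
      _ = _ := by ring
  calc ENNReal.ofReal |symWeight c x (x + y) * formInt φ u c (x, x + y)|
      ≤ ENNReal.ofReal (4 * B * min 1 ‖y‖ * |u (x + y) - u x|) := ENNReal.ofReal_le_ofReal h1
    _ = ENNReal.ofReal (4 * B * min 1 ‖y‖) * ENNReal.ofReal |u (x + y) - u x| :=
        ENNReal.ofReal_mul (by positivity)
    _ ≤ ENNReal.ofReal (4 * B * min 1 ‖y‖) * (ENNReal.ofReal ‖y‖ * M) := by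
        gcongr
        exact hM x y
    _ = _ := by
        rw [← mul_assoc, ← ENNReal.ofReal_mul (by positivity)]
        congr 2
        ring

/-- The bilinear form of `κ`, tested with a mollifier at `c`, is close to the translation
invariant operator with kernel `κ 0` applied to the mollification. -/
lemma IsMollifier.abs_form_sub_le [ProbabilityTheory.IsSFiniteKernel κ]
    (h : IsMollifier τ B φ) (hB : 0 ≤ B) (hτ : τ < 1)
    (hα0 : 0 < α) (hα1 : α < 1) (hp : 1 + α < β) (hβ : β < 2) (hL : 0 ≤ Lam) (hδ : 0 ≤ δ)
    (hU : ∀ x, UpperBd β Lam (κ x))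
    (hsym : ∀ A B : Set (Euc n), MeasurableSet A → MeasurableSet B → Disjoint A B →
      ∫⁻ x in A, κ x ((fun y => x + y) ⁻¹' B) = ∫⁻ x in B, κ x ((fun y => x + y) ⁻¹' A))
    (htv : ∀ x, ∀ ρ : ℝ, 0 < ρ →
      M * tvDiff (κ x) (κ 0) (annulus n ρ) ≤ ENNReal.ofReal (δ * ‖x‖ ^ α * ρ ^ (-β)))
    (hneg : ∀ ρ : ℝ, 0 < ρ →
      M * tvDiff (κ 0) (Measure.map (fun y => -y) (κ 0)) (annulus n ρ) ≤
        ENNReal.ofReal (δ * ρ ^ (α - β)))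
    (hu : Continuous u)
    (hα : ∀ x x' k, |(u (x + k) - u x) - (u (x' + k) - u x')| ≤ ‖k‖ * ‖x - x'‖ ^ α)
    (hL' : 0 ≤ L) (hT : ∀ y, |u (c + y) - u c| ≤ L * ‖y‖ + ‖y‖ ^ (1 + α))
    (hM : ∀ x y, ENNReal.ofReal |u (x + y) - u x| ≤ ENNReal.ofReal ‖y‖ * M)
    {R : ℝ} (hR : ‖c‖ ≤ R) :
    |2 * (∫ x, ∫ y, formInt φ u c (x, x + y) ∂(κ x)) -
        2 * ∫ y, secDiff (moll φ u) c y ∂(κ 0)| ≤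
      3 * (8 * (4 * B) * δ * ((R + 2) ^ α + 1) * wgtSum (1 + α) β) *
        volume.real (ball (0 : Euc n) 2) := by
  have hp0 : 0 ≤ 1 + α := by linarith
  have hR0 : 0 ≤ R := (norm_nonneg c).trans hR
  set κ₀' : Measure (Euc n) := Measure.map (fun y => -y) (κ 0) with hκ'
  have hU' : UpperBd β Lam κ₀' := (hU 0).map_neg
  set μ : Measure (Euc n) := κ 0 + κ₀' with hμ
  have hUμ : UpperBd β (2 * Lam) μ := (hU 0).add hL hU'
  have hsfin : SFinite μ := hUμ.sFinite
  have hFb : ∀ x ∈ ball c 2, ∀ y, |formInt φ u c (x, x + y)| ≤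
      2 * B * (L + 3) * wgt (1 + α) ‖y‖ :=
    fun x hx y => h.abs_formInt_le_wgt hB hα0.le hα1.le hα hL' hT hx y
  have hC0 : 0 ≤ 2 * B * (L + 3) := by positivity
  have hFc := h.continuous_formInt hu c
  obtain ⟨-, hDi, hDe⟩ := integral_symm_eq hp0 hp hβ hL hC0 hU hsym hFc
    (formInt_swap φ u c) (fun x z hx hz => h.formInt_eq_zero hτ hx hz) hFb
  obtain ⟨hEI, hEi, hEe⟩ := integral_symm_eq
    (κ := ProbabilityTheory.Kernel.const (Euc n) μ) hp0 hp hβ (by positivity : 0 ≤ 2 * Lam) hC0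
    (fun x => by simpa using hUμ)
    (fun A B hA hB _ => by
      simp only [ProbabilityTheory.Kernel.const_apply]
      exact setLIntegral_symm_of_even (map_neg_add_map_neg (κ 0)) hA hB) hFc
    (formInt_swap φ u c) (fun x z hx hz => h.formInt_eq_zero hτ hx hz) hFb
  simp only [ProbabilityTheory.Kernel.const_apply] at hEi hEe
  have hE2 := h.integral_formInt_const hu hEI
  set g : Euc n → Euc n → ℝ := fun x y => symWeight c x (x + y) * formInt φ u c (x, x + y)
    with hg
  have hsecb := h.abs_secDiff_moll_le hB hτ.le hu hα0 hα1 hα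
  have hseci : Integrable (secDiff (moll φ u) c) (κ 0) :=
    integrable_secDiff (hU 0) hp0 hp hβ hL (h.continuous_moll hu) hsecb c
  have hseci' : Integrable (secDiff (moll φ u) c) κ₀' :=
    integrable_secDiff hU' hp0 hp hβ hL (h.continuous_moll hu) hsecb c
  have hsec : ∫ y, secDiff (moll φ u) c y ∂μ = 2 * ∫ y, secDiff (moll φ u) c y ∂(κ 0) := by
    rw [hμ, integral_add_measure hseci hseci', two_mul]
    congr 1
    refine (integral_map_equiv (MeasurableEquiv.neg (Euc n)) _).trans ?_
    refine integral_congr_ae (Filter.Eventually.of_forall fun y => ?_)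
    simp only [secDiff, MeasurableEquiv.neg_apply, sub_neg_eq_add, ← sub_eq_add_neg]
    ring
  have hgi : ∀ x ∈ ball c 2, ∀ ν, UpperBd β Lam ν → Integrable (g x) ν := by
    intro x hx ν hν
    refine ((hν.integrable_wgt hp0 hp hβ hL).const_mul (2 * (2 * B * (L + 3)))).mono' ?_
      (Filter.Eventually.of_forall fun y => ?_)
    · refine Measurable.aestronglyMeasurable ?_
      exact ((measurable_symWeight c).comp
        (measurable_const.prodMk (measurable_const.add measurable_id))).mul
        (hFc.measurable.comp (measurable_const.prodMk (measurable_const.add measurable_id)))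
    · rw [hg, Real.norm_eq_abs, abs_mul, abs_of_nonneg (symWeight_nonneg c x _), mul_assoc 2]
      exact mul_le_mul (symWeight_le_two c x _) (hFb x hx y) (abs_nonneg _) zero_le_two
  have hpt : ∀ x ∈ ball c 2, |2 * (∫ y, g x y ∂(κ x)) - ∫ y, g x y ∂μ| ≤
      3 * (8 * (4 * B) * δ * ((R + 2) ^ α + 1) * wgtSum (1 + α) β) := by
    intro x hx
    have hxR : ‖x‖ ^ α ≤ (R + 2) ^ α := by
      refine Real.rpow_le_rpow (norm_nonneg x) ?_ hα0.le
      have h1 : ‖x - c‖ < 2 := by simpa [dist_eq_norm] using hx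
      have h2 := norm_le_norm_add_norm_sub' x c
      linarith
    have hgM := fun y => h.ofReal_abs_symWeight_formInt_le hB hM c x y
    have hW := wgtSum_nonneg (1 + α) β
    have k1 := abs_integral_sub_le (a := (R + 2) ^ α) hα0 hp hβ (hU x) (hU 0) hδ
      (by positivity) (by positivity : 0 ≤ 4 * B)
      (fun ρ hρ => (htv x ρ hρ).trans (ENNReal.ofReal_le_ofReal (by
        have : ‖x‖ ^ α ≤ (R + 2) ^ α + ρ ^ α := hxR.trans (by
          have : 0 ≤ ρ ^ α := by positivity
          linarith)
        gcongr))) (hgi x hx _ (hU x)) (hgi x hx _ (hU 0)) hgM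
    have k2 := abs_integral_sub_le (a := (R + 2) ^ α) hα0 hp hβ (hU 0) hU' hδ
      (by positivity) (by positivity : 0 ≤ 4 * B)
      (fun ρ hρ => (hneg ρ hρ).trans (ENNReal.ofReal_le_ofReal (by
        rw [sub_eq_add_neg, Real.rpow_add hρ, ← mul_assoc]
        have : ρ ^ α ≤ (R + 2) ^ α + ρ ^ α := by
          have : 0 ≤ (R + 2) ^ α := by positivity
          linarith
        gcongr))) (hgi x hx _ (hU 0)) (hgi x hx _ hU') hgM
    rw [hμ, integral_add_measure (hgi x hx _ (hU 0)) (hgi x hx _ hU')]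
    rw [abs_le] at k1 k2 ⊢
    constructor <;> linarith
  rw [hDe, ← hsec, ← hE2, hEe, ← integral_const_mul, ← integral_sub (hDi.const_mul 2) hEi,
    ← Real.norm_eq_abs]
  rw [← setIntegral_eq_integral_of_forall_compl_eq_zero (s := ball c 2)]
  · have hv : volume.real (ball c 2) = volume.real (ball (0 : Euc n) 2) := by
      simp only [Measure.real, Measure.addHaar_ball_center]
    rw [← hv]
    exact norm_setIntegral_le_of_norm_le_const measure_ball_lt_top fun x hx => hpt x hx
  · intro x hx
    simp [symWeight_eq_zero hx]

end Comparison

section Jump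

variable {K : Euc n → Measure (Euc n)} {α δ β : ℝ} {M : ℝ≥0∞}

lemma tvDiff_congr_restrict {μ μ' ν ν' : Measure (Euc n)} {A : Set (Euc n)}
    (hμ : μ.restrict A = μ'.restrict A) (hν : ν.restrict A = ν'.restrict A) :
    tvDiff μ ν A = tvDiff μ' ν' A := by
  simp only [tvDiff, hμ, hν]

lemma tvDiff_jump_zero (K : Euc n → Measure (Euc n)) (x : Euc n) {ρ : ℝ} (hρ : 0 < ρ) :
    tvDiff (jump K x) (jump K 0) (annulus n ρ) =
      tvDiff (Measure.map (fun z => z - x) (K (0 + x))) (K 0) (ball 0 (2 * ρ) \ ball 0 ρ) := by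
  rw [zero_add]
  refine tvDiff_congr_restrict (jump_restrict_annulus K x hρ) ?_
  rw [jump_restrict_annulus K 0 hρ]
  simp [annulus]

lemma tvDiff_jump_neg (K : Euc n → Measure (Euc n)) {ρ : ℝ} (hρ : 0 < ρ) :
    tvDiff (jump K 0) (Measure.map (fun y => -y) (jump K 0)) (annulus n ρ) =
      tvDiff (Measure.map (fun z => z - 0) (K 0)) (Measure.map (fun z => 0 - z) (K 0))
        (ball 0 (2 * ρ) \ ball 0 ρ) := by
  refine tvDiff_congr_restrict (jump_restrict_annulus K 0 hρ) ?_
  have h1 := jump_restrict_annulus K 0 hρ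
  have hm := measurableSet_annulus (n := n) ρ
  change _ = (Measure.map (fun z => 0 - z) (K 0)).restrict (annulus n ρ)
  rw [Measure.restrict_map measurable_neg hm, neg_preimage_annulus, h1]
  conv_lhs => rw [← neg_preimage_annulus ρ]
  rw [← Measure.restrict_map measurable_neg hm, Measure.map_map measurable_neg (by fun_prop)]
  congr 2
  ext1 z
  simp

lemma integral_jump {x : Euc n} {g : Euc n → ℝ} (hg : g x = 0) :
    ∫ y, g (x + y) ∂(jump K x) = ∫ z, g z ∂(K x) := by
  rw [jump, setIntegral_eq_integral_of_forall_compl_eq_zero]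
  · refine (integral_map_equiv (MeasurableEquiv.subRight x) _).trans ?_
    refine integral_congr_ae (Filter.Eventually.of_forall fun z => ?_)
    change g (x + (z - x)) = g z
    rw [add_sub_cancel]
  · intro y hy
    have : y = 0 := by simpa using hy
    rw [this, add_zero, hg]

end Jump

lemma abs_integral_mul_le {q B δ r : ℝ} (hq : 1 ≤ q) (hB : 0 ≤ B) (hδ : 0 ≤ δ)
    {f η : Euc n → ℝ} {c : Euc n} (hf : eLpNorm f (ENNReal.ofReal q) (volume.restrict (ball 0 r)) ≤
      ENNReal.ofReal δ) (hc : ball c 1 ⊆ ball 0 r) (hη : ∀ x, |η x| ≤ B)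
    (hη0 : ∀ x, x ∉ ball c 1 → η x = 0) :
    |∫ x, f x * η x| ≤ B * δ * (volume (ball (0 : Euc n) 1) ^ (1 - 1 / q)).toReal := by
  by_cases hm : AEStronglyMeasurable (fun x => f x * η x) (volume : Measure (Euc n))
  swap
  · rw [integral_undef fun h => hm h.1, abs_zero]
    positivity
  have hq' : (1 : ℝ≥0∞) ≤ ENNReal.ofReal q := by
    rw [← ENNReal.ofReal_one]
    exact ENNReal.ofReal_le_ofReal hq
  have hV : volume (ball (0 : Euc n) 1) ^ (1 - 1 / q) ≠ ⊤ := by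
    refine ENNReal.rpow_ne_top_of_nonneg ?_ measure_ball_lt_top.ne
    have : 1 / q ≤ 1 := by
      rw [div_le_one (by linarith)]
      exact hq
    linarith
  have h1 : eLpNorm (fun x => f x * η x) (ENNReal.ofReal q) (volume.restrict (ball c 1)) ≤
      ENNReal.ofReal B * ENNReal.ofReal δ := by
    calc eLpNorm (fun x => f x * η x) (ENNReal.ofReal q) (volume.restrict (ball c 1))
        ≤ eLpNorm (fun x => f x * η x) (ENNReal.ofReal q) (volume.restrict (ball 0 r)) :=
          eLpNorm_mono_measure _ (Measure.restrict_mono hc le_rfl)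
      _ ≤ ENNReal.ofReal B * eLpNorm f (ENNReal.ofReal q) (volume.restrict (ball 0 r)) := by
          refine eLpNorm_le_mul_eLpNorm_of_ae_le_mul (Filter.Eventually.of_forall fun x => ?_) _
          rw [norm_mul, mul_comm]
          exact mul_le_mul_of_nonneg_right (hη x) (norm_nonneg _)
      _ ≤ _ := by gcongr
  have h2 := eLpNorm_le_eLpNorm_mul_rpow_measure_univ hq' (hm.restrict (s := ball c 1))
  rw [Measure.restrict_apply_univ, Measure.addHaar_ball_center, ENNReal.toReal_one, div_one,
    ENNReal.toReal_ofReal (by linarith)] at h2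
  have h3 : |∫ x, f x * η x| ≤
      (eLpNorm (fun x => f x * η x) 1 (volume.restrict (ball c 1))).toReal := by
    rw [← setIntegral_eq_integral_of_forall_compl_eq_zero (s := ball c 1)
      fun x hx => by rw [hη0 x hx, mul_zero], eLpNorm_one_eq_lintegral_enorm, ← Real.norm_eq_abs]
    exact norm_integral_le_lintegral_norm _ |>.trans_eq (by simp [Real.enorm_eq_ofReal_abs])
  refine h3.trans ?_
  have h4 := ENNReal.toReal_mono (ENNReal.mul_ne_top
    (ENNReal.mul_ne_top ENNReal.ofReal_ne_top ENNReal.ofReal_ne_top) hV)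
    (h2.trans (mul_le_mul_left h1 _))
  rwa [ENNReal.toReal_mul, ENNReal.toReal_mul, ENNReal.toReal_ofReal hB,
    ENNReal.toReal_ofReal hδ] at h4

section Regularity

variable {u : Euc n → ℝ} {α : ℝ}

lemma hDeg_one_add (hα : α ∈ Ioo (0 : ℝ) 1) : hDeg (1 + α) = 1 := by
  have : ⌈1 + α⌉₊ = 2 := by
    rw [Nat.ceil_eq_iff (by norm_num)]
    constructor <;> norm_num <;> linarith [hα.1, hα.2]
  rw [hDeg, this]

lemma norm_fderiv_sub_le (hα : α ∈ Ioo (0 : ℝ) 1) (h : hSemi (1 + α) univ u ≤ 1) (x y : Euc n) :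
    ‖fderiv ℝ u x - fderiv ℝ u y‖ ≤ ‖x - y‖ ^ α := by
  rcases eq_or_ne x y with rfl | hxy
  · simp [Real.zero_rpow hα.1.ne']
  have hpos : 0 < ‖x - y‖ ^ α := Real.rpow_pos_of_pos (norm_pos_iff.mpr (sub_ne_zero.mpr hxy)) _
  have h1 := (le_iSup₂ (f := fun (x y : (univ : Set (Euc n))) => ENNReal.ofReal
      (‖iteratedFDerivWithin ℝ (hDeg (1 + α)) u univ ↑x -
        iteratedFDerivWithin ℝ (hDeg (1 + α)) u univ ↑y‖ /
        ‖(x : Euc n) - (y : Euc n)‖ ^ (1 + α - (hDeg (1 + α) : ℝ))))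
      ⟨x, mem_univ x⟩ ⟨y, mem_univ y⟩).trans h
  rw [hDeg_one_add hα] at h1
  simp only [iteratedFDerivWithin_univ, Nat.cast_one, add_sub_cancel_left,
    ENNReal.ofReal_le_one] at h1
  rw [div_le_one hpos] at h1
  refine ContinuousLinearMap.opNorm_le_bound _ hpos.le fun v => ?_
  have h2 := (iteratedFDeriv ℝ 1 u x - iteratedFDeriv ℝ 1 u y).le_opNorm fun _ => v
  simp only [sub_apply, iteratedFDeriv_one_apply, Finset.prod_const,
    Finset.card_univ, Fintype.card_fin, pow_one] at h2
  exact h2.trans (by gcongr)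

lemma abs_increment_sub_le (hu : ContDiff ℝ 1 u)
    (h : ∀ x y, ‖fderiv ℝ u x - fderiv ℝ u y‖ ≤ ‖x - y‖ ^ α) (x x' k : Euc n) :
    |(u (x + k) - u x) - (u (x' + k) - u x')| ≤ ‖k‖ * ‖x - x'‖ ^ α := by
  have hd : Differentiable ℝ u := hu.differentiable one_ne_zero
  have hd' : ∀ w, HasFDerivAt (fun w => u (x + w) - u (x' + w))
      (fderiv ℝ u (x + w) - fderiv ℝ u (x' + w)) w := fun w =>
    ((hasFDerivAt_comp_add_left x).mpr (hd _).hasFDerivAt).sub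
      ((hasFDerivAt_comp_add_left x').mpr (hd _).hasFDerivAt)
  have h1 := convex_univ.norm_image_sub_le_of_norm_hasFDerivWithin_le
    (fun w _ => (hd' w).hasFDerivWithinAt) (C := ‖x - x'‖ ^ α)
    (fun w _ => (h _ _).trans_eq (by rw [add_sub_add_right_eq_sub])) (mem_univ 0) (mem_univ k)
  rw [add_zero, add_zero, sub_zero, Real.norm_eq_abs] at h1
  rw [mul_comm]
  convert h1 using 2
  ring

lemma abs_sub_affine_le (hu : ContDiff ℝ 1 u) {s : Set (Euc n)} (hs : Convex ℝ s) {C : ℝ}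
    {c y : Euc n} (hc : c ∈ s) (hy : c + y ∈ s)
    (h : ∀ x ∈ s, ‖fderiv ℝ u x - fderiv ℝ u c‖ ≤ C) :
    |u (c + y) - u c - fderiv ℝ u c y| ≤ C * ‖y‖ := by
  have hd : Differentiable ℝ u := hu.differentiable one_ne_zero
  have h1 := hs.norm_image_sub_le_of_norm_hasFDerivWithin_le
    (f := fun x => u x - fderiv ℝ u c x) (f' := fun x => fderiv ℝ u x - fderiv ℝ u c)
    (fun x _ => ((hd x).hasFDerivAt.sub (fderiv ℝ u c).hasFDerivAt).hasFDerivWithinAt) h hc hy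
  rw [add_sub_cancel_left, Real.norm_eq_abs, map_add] at h1
  convert h1 using 2
  ring

lemma abs_sub_affine_le_rpow (hα : 0 ≤ α) (hu : ContDiff ℝ 1 u)
    (h : ∀ x y, ‖fderiv ℝ u x - fderiv ℝ u y‖ ≤ ‖x - y‖ ^ α) (c y : Euc n) :
    |u (c + y) - u c - fderiv ℝ u c y| ≤ ‖y‖ ^ α * ‖y‖ := by
  refine abs_sub_affine_le hu (convex_closedBall c ‖y‖) (by simp) (by simp) fun x hx => ?_
  refine (h x c).trans (Real.rpow_le_rpow (norm_nonneg _) ?_ hα)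
  simpa [dist_eq_norm] using hx

lemma ofReal_abs_sub_le_gradSup (hu : ContDiff ℝ 1 u) (x y : Euc n) :
    ENNReal.ofReal |u (x + y) - u x| ≤ ENNReal.ofReal ‖y‖ * gradSup u := by
  rcases eq_or_ne y 0 with rfl | hy
  · simp
  have hy' : ENNReal.ofReal ‖y‖ ≠ 0 := by simpa using hy
  rcases eq_or_ne (gradSup u) ⊤ with hM | hM
  · rw [hM, ENNReal.mul_top hy']
    exact le_top
  have hb : ∀ z, ‖fderiv ℝ u z‖ ≤ (gradSup u).toReal := fun z =>
    (ENNReal.ofReal_le_iff_le_toReal hM).mp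
      (le_iSup (fun z => ENNReal.ofReal ‖fderiv ℝ u z‖) z)
  have h1 := convex_univ.norm_image_sub_le_of_norm_fderiv_le
    (fun z _ => hu.differentiable one_ne_zero z) (fun z _ => hb z) (mem_univ x)
    (mem_univ (x + y))
  rw [add_sub_cancel_left, Real.norm_eq_abs] at h1
  calc ENNReal.ofReal |u (x + y) - u x| ≤ ENNReal.ofReal ((gradSup u).toReal * ‖y‖) :=
        ENNReal.ofReal_le_ofReal h1
    _ = _ := by
        rw [mul_comm, ENNReal.ofReal_mul (norm_nonneg y), ENNReal.ofReal_toReal hM]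

lemma c1Norm_sub_affine_le (hu : ContDiff ℝ 1 u) {ε : ℝ} (hε : 0 ≤ ε)
    (h : ∀ x ∈ ball (0 : Euc n) 1, ‖fderiv ℝ u x - fderiv ℝ u 0‖ ≤ ε / 2) :
    c1Norm (ball 0 1) (fun x => u x - (u 0 + fderiv ℝ u 0 x)) ≤ ENNReal.ofReal ε := by
  have hd : Differentiable ℝ u := hu.differentiable one_ne_zero
  rw [← add_halves ε, ENNReal.ofReal_add (by positivity) (by positivity)]
  refine add_le_add (iSup_le fun x => ENNReal.ofReal_le_ofReal ?_)
    (iSup_le fun x => ENNReal.ofReal_le_ofReal ?_)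
  · have hx : ‖(x : Euc n)‖ < 1 := mem_ball_zero_iff.mp x.2
    have h1 := abs_sub_affine_le (y := (x : Euc n)) hu (convex_ball 0 1)
      (mem_ball_self one_pos) (by simp) h
    rw [zero_add] at h1
    change |u x - (u 0 + fderiv ℝ u 0 x)| ≤ ε / 2
    rw [← sub_sub]
    exact h1.trans (mul_le_of_le_one_right (by positivity) hx.le)
  · have h2 : HasFDerivAt (fun x => u x - (u 0 + fderiv ℝ u 0 x))
        (fderiv ℝ u x - fderiv ℝ u 0) (x : Euc n) :=
      (hd x).hasFDerivAt.sub ((fderiv ℝ u 0).hasFDerivAt.const_add (u 0))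
    rw [h2.fderiv]
    exact h x x.2

end Regularity

section Assembly

variable {K : Euc n → Measure (Euc n)} {u f φ : Euc n → ℝ} {s α q lam Lam δ τ B : ℝ}

/-- Smallness of the translation invariant operator with the frozen kernel `jump K 0` on
mollifications of a weak solution. -/
lemma IsMollifier.abs_integral_secDiff_le (h : IsMollifier τ B φ) (hB : 0 ≤ B) (hτ : τ < 1)
    (hα : α ∈ Ioo (0 : ℝ) 1) (hα2 : 1 + α < 2 * s) (hs : s < 1) (hq : 1 ≤ q)
    (hL : 0 ≤ Lam) (hδ : 0 < δ) (hS : DivSymmetric K) (hE : DivElliptic s lam Lam K)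
    (hu : ContDiff ℝ 1 u)
    (hgrad : ∀ x y, ‖fderiv ℝ u x - fderiv ℝ u y‖ ≤ ‖x - y‖ ^ α)
    (hf : eLpNorm f (ENNReal.ofReal q) (volume.restrict (ball 0 (1 / δ))) ≤ ENNReal.ofReal δ)
    (htv : ∀ x h : Euc n, ∀ ρ : ℝ, 0 < ρ →
      gradSup u * tvDiff (Measure.map (fun z => z - h) (K (x + h))) (K x)
        (ball x (2 * ρ) \ ball x ρ) ≤ ENNReal.ofReal (δ * ‖h‖ ^ α * ρ ^ (-(2 * s))))
    (hneg : ∀ x : Euc n, ∀ ρ : ℝ, 0 < ρ →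
      gradSup u * tvDiff (Measure.map (fun z => z - x) (K x)) (Measure.map (fun z => x - z) (K x))
        (ball 0 (2 * ρ) \ ball 0 ρ) ≤ ENNReal.ofReal (δ * ρ ^ (α - 2 * s)))
    (hW : WeakSol K u f (ball 0 (1 / δ))) (hM : gradSup u ≠ 0)
    {R : ℝ} (hR : 0 ≤ R) (hRδ : R + 1 ≤ 1 / δ) {c : Euc n} (hc : c ∈ ball 0 R) :
    |∫ y, secDiff (moll φ u) c y ∂(jump K 0)| ≤
      δ * (2 * B * (volume (ball (0 : Euc n) 1) ^ (1 - 1 / q)).toReal +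
        3 * (8 * (4 * B) * ((R + 2) ^ α + 1) * wgtSum (1 + α) (2 * s)) *
          volume.real (ball (0 : Euc n) 2)) := by
  let κ : ProbabilityTheory.Kernel (Euc n) (Euc n) :=
    ⟨jump K, measurable_jump hα.1 hδ.le hE hM htv⟩
  have hU : ∀ x, UpperBd (2 * s) Lam (κ x) := fun x => UpperBd.jump hE x
  have hsfin : ProbabilityTheory.IsSFiniteKernel κ := isSFiniteKernel_of_upperBd hU
  have huc : Continuous u := hu.continuous
  have hc' : ‖c‖ < R := by simpa using hc
  have hα' := abs_increment_sub_le hu hgrad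
  have hT : ∀ y, |u (c + y) - u c| ≤ ‖fderiv ℝ u c‖ * ‖y‖ + ‖y‖ ^ (1 + α) := by
    intro y
    have h1 := abs_sub_affine_le_rpow hα.1.le hu hgrad c y
    have h2 := (fderiv ℝ u c).le_opNorm y
    have h3 := abs_sub_abs_le_abs_sub (u (c + y) - u c) (fderiv ℝ u c y)
    have h4 : ‖y‖ ^ (1 + α) = ‖y‖ ^ α * ‖y‖ := by
      rw [add_comm, Real.rpow_add_one' (norm_nonneg y) (by linarith [hα.1])]
    rw [Real.norm_eq_abs] at h2
    rw [h4]
    linarith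
  have hmain := h.abs_form_sub_le (κ := κ) (c := c) hB hτ hα.1 hα.2 hα2 (by linarith) hL hδ.le hU
    (fun A B hA hB hAB => setLIntegral_jump_symm hS hA hB hAB)
    (fun x ρ hρ => (congrArg (gradSup u * ·) (tvDiff_jump_zero K x hρ)).trans_le (htv 0 x ρ hρ))
    (fun ρ hρ => (congrArg (gradSup u * ·) (tvDiff_jump_neg K hρ)).trans_le (hneg 0 ρ hρ))
    huc hα' (norm_nonneg _) hT (ofReal_abs_sub_le_gradSup hu) hc'.le
  have hball : ball c 1 ⊆ ball 0 (1 / δ) := by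
    refine ball_subset_ball' ?_
    rw [dist_zero_right]
    linarith
  have hη0 : ∀ x, x ∉ ball c 1 → φ (c - x) = 0 := fun x hx => h.eq_zero_of_notMem hτ hx
  have hts : tsupport (fun x => φ (c - x)) ⊆ closedBall c τ := by
    refine closure_minimal (fun x hx => ?_) isClosed_closedBall
    rw [mem_closedBall, dist_comm, dist_eq_norm]
    by_contra! hlt
    exact hx (h.eq_zero _ hlt)
  have hweak := hW.2.2 (fun x => φ (c - x)) (h.contDiff.comp (contDiff_const.sub contDiff_id))
    (IsCompact.of_isClosed_subset (isCompact_closedBall c τ) (isClosed_tsupport _) hts)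
    ((hts.trans (closedBall_subset_ball hτ)).trans hball)
  have hform : ∫ x, ∫ y, formInt φ u c (x, x + y) ∂(κ x) = 2 * ∫ x, f x * φ (c - x) := by
    rw [← hweak, ← mul_assoc]
    norm_num
    refine integral_congr_ae (Filter.Eventually.of_forall fun x => ?_)
    exact integral_jump (g := fun z => formInt φ u c (x, z)) (by simp [formInt])
  have hfb := abs_integral_mul_le hq hB hδ.le hf hball (η := fun x => φ (c - x))
    (fun x => h.bound _) hη0
  rw [hform] at hmain
  change |2 * (2 * ∫ x, f x * φ (c - x)) - 2 * ∫ y, secDiff (moll φ u) c y ∂(jump K 0)| ≤ _ at hmain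
  have hW0 := wgtSum_nonneg (1 + α) (2 * s)
  have hnn : 0 ≤ 3 * (8 * (4 * B) * δ * ((R + 2) ^ α + 1) * wgtSum (1 + α) (2 * s)) *
    volume.real (ball (0 : Euc n) 2) := by positivity
  have hre : δ * (2 * B * (volume (ball (0 : Euc n) 1) ^ (1 - 1 / q)).toReal +
        3 * (8 * (4 * B) * ((R + 2) ^ α + 1) * wgtSum (1 + α) (2 * s)) *
          volume.real (ball (0 : Euc n) 2)) =
      2 * (B * δ * (volume (ball (0 : Euc n) 1) ^ (1 - 1 / q)).toReal) +
        3 * (8 * (4 * B) * δ * ((R + 2) ^ α + 1) * wgtSum (1 + α) (2 * s)) *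
          volume.real (ball (0 : Euc n) 2) := by ring
  rw [hre]
  rw [abs_le] at hmain hfb ⊢
  constructor <;> linarith [hmain.1, hmain.2, hfb.1, hfb.2]

/-- Almost affine increments of a mollification control the oscillation of the gradient. -/
lemma IsMollifier.norm_fderiv_sub_fderiv_zero_le (h : IsMollifier τ B φ) (hα : 0 ≤ α)
    (hu : ContDiff ℝ 1 u)
    (hgrad : ∀ x y, ‖fderiv ℝ u x - fderiv ℝ u y‖ ≤ ‖x - y‖ ^ α) {t b : ℝ} (ht : 0 < t)
    (hb : 0 ≤ b) (htb : t ^ α ≤ b) (hτb : τ ^ α ≤ b) {x : Euc n}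
    (hinc : ∀ k, ‖k‖ = t →
      |(moll φ u (x + k) - moll φ u x) - (moll φ u k - moll φ u 0)| ≤ t * b) :
    ‖fderiv ℝ u x - fderiv ℝ u 0‖ ≤ 5 * b := by
  refine ContinuousLinearMap.opNorm_le_bound _ (by positivity) fun v => ?_
  rcases eq_or_ne v 0 with rfl | hv
  · simp
  have hv' : 0 < ‖v‖ := norm_pos_iff.mpr hv
  set k : Euc n := (t / ‖v‖) • v with hk
  have hkn : ‖k‖ = t := by
    rw [hk, norm_smul, Real.norm_eq_abs, abs_of_pos (by positivity)]
    field_simp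
  have hα' := abs_increment_sub_le hu hgrad
  have h1 := hinc k hkn
  have h2 := h.moll_approx hu.continuous hα hα' x k
  have h3 := h.moll_approx hu.continuous hα hα' 0 k
  have h4 := abs_sub_affine_le_rpow hα hu hgrad x k
  have h5 := abs_sub_affine_le_rpow hα hu hgrad 0 k
  rw [zero_add] at h3 h5
  rw [hkn] at h2 h3 h4 h5
  have h6 : t * τ ^ α ≤ t * b := by gcongr
  have h7 : t ^ α * t ≤ t * b := by
    rw [mul_comm]
    gcongr
  have h8 : |fderiv ℝ u x k - fderiv ℝ u 0 k| ≤ 5 * b * t := by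
    rw [abs_le] at *
    constructor <;> linarith [h1.1, h1.2, h2.1, h2.2, h3.1, h3.2, h4.1, h4.2, h5.1, h5.2]
  have h9 : v = (‖v‖ / t) • k := by
    rw [hk, smul_smul, div_mul_div_comm, mul_comm, div_self (by positivity), one_smul]
  calc ‖(fderiv ℝ u x - fderiv ℝ u 0) v‖ = ‖v‖ / t * |fderiv ℝ u x k - fderiv ℝ u 0 k| := by
        conv_lhs => rw [h9]
        rw [map_smul, norm_smul, Real.norm_eq_abs, abs_of_pos (by positivity), sub_apply,
          Real.norm_eq_abs]
    _ ≤ ‖v‖ / t * (5 * b * t) := by gcongr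
    _ = 5 * b * ‖v‖ := by field_simp

end Assembly

/-- **Quantitative Liouville-type estimate for divergence-form equations** (Proposition 4.2).
Under the `δ`-smallness conditions (weighted by `‖∇u‖_∞`) on the kernel, a weak solution
`u` of `L(u,x) = f` in `B_{1/δ}` with `[u]_{C^{1+α}(ℝⁿ)} ≤ 1`, finite `L^∞_{2s-ε}` norm and
`‖f‖_{L^q(B_{1/δ})} ≤ δ` satisfies `‖u − ℓ‖_{C¹(B₁)} ≤ ε₀` whenever `δ < δ₀(ε₀)`, where
`ℓ(x) = u(0) + ∇u(0)·x`. -/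
theorem stmt7 (n : ℕ) (s α q ε lam Lam : ℝ)
    (hs : s ∈ Set.Ioo (1 / 2 : ℝ) 1) (hα : α ∈ Set.Ioo (0 : ℝ) 1) (hα2 : 1 + α < 2 * s)
    (hq : 1 ≤ q) (hε : 0 < ε) (hlam : 0 < lam) (hlamLam : lam ≤ Lam) :
    ∀ ε₀ > (0 : ℝ), ∃ δ₀ > (0 : ℝ), ∀ δ : ℝ, 0 < δ → δ < δ₀ →
      ∀ (K : Euc n → Measure (Euc n)) (u f : Euc n → ℝ),
        MeasKernel K → DivSymmetric K → DivElliptic s lam Lam K →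
        ContDiff ℝ 1 u →
        hSemi (1 + α) Set.univ u ≤ 1 →
        supNormW (2 * s - ε) u ≠ ⊤ →
        eLpNorm f (ENNReal.ofReal q) (volume.restrict (ball 0 (1 / δ))) ≤ ENNReal.ofReal δ →
        (∀ x h : Euc n, ∀ ρ : ℝ, 0 < ρ →
          gradSup u *
              tvDiff (Measure.map (fun z => z - h) (K (x + h))) (K x)
                (ball x (2 * ρ) \ ball x ρ) ≤
            ENNReal.ofReal (δ * ‖h‖ ^ α * ρ ^ (-(2 * s)))) →
        (∀ x : Euc n, ∀ ρ : ℝ, 0 < ρ →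
          gradSup u *
              tvDiff (Measure.map (fun z => z - x) (K x)) (Measure.map (fun z => x - z) (K x))
                (ball 0 (2 * ρ) \ ball 0 ρ) ≤
            ENNReal.ofReal (δ * ρ ^ (α - 2 * s))) →
        WeakSol K u f (ball 0 (1 / δ)) →
        c1Norm (ball 0 1) (fun x => u x - (u 0 + fderiv ℝ u 0 x)) ≤ ENNReal.ofReal ε₀ := by
  intro ε₀ hε₀
  have hb : 0 < ε₀ / 12 := by positivity
  have hL : 0 ≤ Lam := hlam.le.trans hlamLam
  obtain ⟨t, ht, ht1, htα⟩ := exists_rpow_le hα.1 hb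
  have hτ : 0 < min t (1 / 2) := by positivity
  obtain ⟨B, φ, hB, hφ⟩ := exists_isMollifier (n := n) hτ
  obtain ⟨R, δ', hR, hδ', H⟩ := almost_affine (n := n) (p := 1 + α) (β := 2 * s)
    (C := 1 + 2 * B * volume.real (closedBall (0 : Euc n) 2)) hα.1 hα.2 (by linarith [hα.1]) hα2
    (by linarith [hs.2]) hlam hL (by positivity) (mul_pos ht hb)
  set Q : ℝ := 2 * B * (volume (ball (0 : Euc n) 1) ^ (1 - 1 / q)).toReal +
    3 * (8 * (4 * B) * ((R + 2) ^ α + 1) * wgtSum (1 + α) (2 * s)) *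
      volume.real (ball (0 : Euc n) 2) with hQ
  have hW0 := wgtSum_nonneg (1 + α) (2 * s)
  have hQ0 : 0 ≤ Q := by positivity
  refine ⟨min (δ' / (Q + 1)) (1 / (R + 1)), by positivity, ?_⟩
  intro δ hδ hδlt K u f _ hS hE hu hsemi _ hf htv hneg hW
  have hδQ : δ * Q ≤ δ' := by
    have h1 := (lt_div_iff₀ (by positivity)).mp (hδlt.trans_le (min_le_left _ _))
    nlinarith
  have hRδ : R + 1 ≤ 1 / δ := by
    rw [le_div_iff₀ hδ, mul_comm]
    exact ((lt_div_iff₀ (by positivity)).mp (hδlt.trans_le (min_le_right _ _))).le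
  have hgrad := norm_fderiv_sub_le hα hsemi
  have hinc := abs_increment_sub_le hu hgrad
  refine c1Norm_sub_affine_le hu hε₀.le fun x hx => ?_
  by_cases hM : gradSup u = 0
  · have hz : ∀ y, fderiv ℝ u y = 0 := fun y =>
      norm_le_zero_iff.mp (ENNReal.ofReal_eq_zero.mp (ENNReal.iSup_eq_zero.mp hM y))
    rw [hz x, hz 0, sub_zero, norm_zero]
    positivity
  · have key := H (jump K 0) (moll φ u) (UpperBd.jump hE 0) (LowerBd.jump hE 0)
      (hφ.continuous_moll hu.continuous) (hφ.moll_increment_le hu.continuous hinc)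
      (hφ.abs_secDiff_moll_le hB.le ((min_le_left _ _).trans ht1) hu.continuous hα.1 hα.2 hinc)
      (fun c hc => (hφ.abs_integral_secDiff_le hB.le ((min_le_right _ _).trans_lt (by norm_num))
        hα hα2 hs.2 hq hL hδ hS hE hu hgrad hf htv hneg hW hM hR.le hRδ hc).trans hδQ)
    have hx1 : ‖x‖ ≤ 1 := (mem_ball_zero_iff.mp hx).le
    have := hφ.norm_fderiv_sub_fderiv_zero_le hα.1.le hu hgrad ht hb.le (htα t ht.le le_rfl)
      (htα _ hτ.le (min_le_left _ _)) (x := x) fun k hk => key x k hx1 (hk.trans_le ht1)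
    linarith

end
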